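/- arXiv:1205.5869 — 4 statements merged into one kernel-verified Lean document; each statement's English description precedes it below -/
import Mathlib

section
/- If a nonnegative sequence (c_n) is almost monotone decreasing, i.e., there is a constant K such that c_n ≤ K c_m for all n ≥ m, then its sequence of Cesàro means C_n = (1/(n+1))∑_{k=0}^n c_k is also almost monotone decreasing (with a constant depending only on K); that is, AMDS ⊂ AMDMS. -/
open MeasureTheory Finset Real

/-- The Dirichlet kernel `D_n(u) = 1/2 + ∑_{k=1}^n cos(k u)`. -/
noncomputable def dirichletKernel (n : ℕ) (u : ℝ) : ℝ :=
  1 / 2 + ∑ k ∈ Finset.Icc 1 n, Real.cos (k * u)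

/-- The `n`-th partial sum of the Fourier series of a `2π`-periodic function `f`,
`S_n(f;x) = (1/π) ∫_0^{2π} f(t) D_n(x - t) dt`. -/
noncomputable def partialFourierSum (f : ℝ → ℝ) (n : ℕ) (x : ℝ) : ℝ :=
  (1 / Real.pi) * ∫ t in (0 : ℝ)..(2 * Real.pi), f t * dirichletKernel n (x - t)

/-- The normalized `L^p` norm `‖f‖_{L^p} = ((1/2π) ∫_0^{2π} |f(x)|^p dx)^{1/p}`. -/
noncomputable def lpNorm (p : ℝ) (f : ℝ → ℝ) : ℝ :=
  ((1 / (2 * Real.pi)) * ∫ x in (0 : ℝ)..(2 * Real.pi), |f x| ^ p) ^ (1 / p)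

/-- The integral modulus of continuity
`ω_p(f;δ) = sup_{0<|h|≤δ} ((1/2π) ∫_0^{2π} |f(x+h) - f(x)|^p dx)^{1/p}`. -/
noncomputable def intModulus (p : ℝ) (f : ℝ → ℝ) (δ : ℝ) : ℝ :=
  sSup {y : ℝ | ∃ h : ℝ, 0 < |h| ∧ |h| ≤ δ ∧
    y = ((1 / (2 * Real.pi)) * ∫ x in (0 : ℝ)..(2 * Real.pi), |f (x + h) - f x| ^ p) ^ (1 / p)}

/-- `f ∈ Lip(α,p)`: `f` is `2π`-periodic, belongs to `L^p[0,2π]`, and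
`ω_p(f;δ) = O(δ^α)`. -/
def LipClass (α p : ℝ) (f : ℝ → ℝ) : Prop :=
  Function.Periodic f (2 * Real.pi) ∧
  IntervalIntegrable f MeasureTheory.volume 0 (2 * Real.pi) ∧
  IntervalIntegrable (fun x => |f x| ^ p) MeasureTheory.volume 0 (2 * Real.pi) ∧
  ∃ C : ℝ, 0 < C ∧ ∀ δ : ℝ, 0 < δ → intModulus p f δ ≤ C * δ ^ α

/-- The matrix transform `T_n(f;x) = ∑_{k=0}^n a_{n,k} S_k(f;x)`. -/
noncomputable def matrixMeans (a : ℕ → ℕ → ℝ) (f : ℝ → ℝ) (n : ℕ) (x : ℝ) : ℝ :=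
  ∑ k ∈ Finset.range (n + 1), a n k * partialFourierSum f k x

/-- `A_{n,m} = (1/(m+1)) ∑_{k=0}^m a_{n,k}`, the Cesàro mean of the `n`-th row. -/
noncomputable def rowMean (a : ℕ → ℕ → ℝ) (n m : ℕ) : ℝ :=
  (1 / ((m : ℝ) + 1)) * ∑ k ∈ Finset.range (m + 1), a n k

/-- The Riesz means `R_n(f;x) = (1/P_n) ∑_{k=0}^n p_k S_k(f;x)` with weights `w`. -/
noncomputable def rieszMeans (w : ℕ → ℝ) (f : ℝ → ℝ) (n : ℕ) (x : ℝ) : ℝ :=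
  (1 / (∑ k ∈ Finset.range (n + 1), w k)) *
    ∑ k ∈ Finset.range (n + 1), w k * partialFourierSum f k x

/-- The kernel `K_n(u) = ∑_{k=0}^n a_{n,k} sin((k+1/2)u)/(2 sin(u/2))`. -/
noncomputable def matrixKernel (a : ℕ → ℕ → ℝ) (n : ℕ) (u : ℝ) : ℝ :=
  ∑ k ∈ Finset.range (n + 1),
    a n k * (Real.sin (((k : ℝ) + 1 / 2) * u) / (2 * Real.sin (u / 2)))

/-- For an almost monotone decreasing sequence, every term past index `m` is at most `K` times
the mean of the terms up to `m`. -/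
theorem succ_mul_le_mul_sum_range {K : ℝ} {c : ℕ → ℝ}
    (hc : ∀ m n : ℕ, m ≤ n → c n ≤ K * c m) {m n : ℕ} (hmn : m ≤ n) :
    ((m : ℝ) + 1) * c n ≤ K * ∑ k ∈ Finset.range (m + 1), c k := by
  have h := Finset.sum_le_sum fun k (hk : k ∈ Finset.range (m + 1)) =>
    hc k n ((Finset.mem_range_succ_iff.mp hk).trans hmn)
  simpa [Finset.mul_sum] using h

/-- Growth of the partial sums of an almost monotone decreasing sequence. -/
theorem succ_mul_sum_range_le {K : ℝ} {c : ℕ → ℝ}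
    (hc : ∀ m n : ℕ, m ≤ n → c n ≤ K * c m) {m n : ℕ} (hmn : m ≤ n) :
    ((m : ℝ) + 1) * ∑ k ∈ Finset.range (n + 1), c k ≤
      ((m : ℝ) + 1 + ((n : ℝ) - m) * K) * ∑ k ∈ Finset.range (m + 1), c k := by
  induction n, hmn using Nat.le_induction with
  | base => simp
  | succ n hmn ih =>
    rw [Finset.sum_range_succ _ (n + 1)]
    have h := succ_mul_le_mul_sum_range hc (Nat.le_succ_of_le hmn)
    push_cast
    linarith

/-- `AMDS ⊂ AMDMS`: if a nonnegative sequence `c` is almost monotone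
decreasing with constant `K` (`c_n ≤ K c_m` for `m ≤ n`), then its Cesàro means
`C_n = (1/(n+1)) ∑_{k=0}^n c_k` are almost monotone decreasing with a constant
depending only on `K`. -/
theorem AMDS_subset_AMDMS :
    ∀ K : ℝ, ∃ K' : ℝ, ∀ c : ℕ → ℝ, (∀ n, 0 ≤ c n) →
      (∀ m n : ℕ, m ≤ n → c n ≤ K * c m) →
      ∀ m n : ℕ, m ≤ n →
        (1 / ((n : ℝ) + 1)) * ∑ k ∈ Finset.range (n + 1), c k ≤
          K' * ((1 / ((m : ℝ) + 1)) * ∑ k ∈ Finset.range (m + 1), c k) := by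
  intro K
  refine ⟨1 + |K|, fun c hc0 hc m n hmn => ?_⟩
  have hS : 0 ≤ ∑ k ∈ Finset.range (m + 1), c k := Finset.sum_nonneg fun k _ => hc0 k
  have hmn' : (m : ℝ) ≤ n := by exact_mod_cast hmn
  have hm : (0 : ℝ) ≤ m := m.cast_nonneg
  have hcoef : (m : ℝ) + 1 + ((n : ℝ) - m) * K ≤ (1 + |K|) * ((n : ℝ) + 1) := by
    nlinarith [mul_le_mul_of_nonneg_left (le_abs_self K) (sub_nonneg.mpr hmn'),
      mul_nonneg (abs_nonneg K) hm, abs_nonneg K]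
  have h := (succ_mul_sum_range_le hc hmn).trans (mul_le_mul_of_nonneg_right hcoef hS)
  rw [one_div_mul_eq_div, one_div_mul_eq_div, ← mul_div_assoc,
    div_le_div_iff₀ (by positivity) (by positivity)]
  linarith
end

section
/- If a nonnegative sequence (c_n) is almost monotone increasing, i.e., there is a constant K such that c_m ≤ K c_n for all n ≥ m, then its sequence of Cesàro means C_n = (1/(n+1))∑_{k=0}^n c_k is also almost monotone increasing (with a constant depending only on K); that is, AMIS ⊂ AMIMS. -/
open MeasureTheory Finset Real

/-- If `c_j ≤ K c_k` for all `j ≤ k`, then `(n+1) ∑_{k≤m} c_k ≤ K (m+1) ∑_{k≤n} c_k` for `m ≤ n`. -/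
theorem succ_mul_sum_le_of_almost_monotone {K : ℝ} {c : ℕ → ℝ}
    (hK : ∀ m n : ℕ, m ≤ n → c m ≤ K * c n) {m n : ℕ} (hmn : m ≤ n) :
    ((n : ℝ) + 1) * ∑ k ∈ Finset.range (m + 1), c k ≤
      K * (((m : ℝ) + 1) * ∑ k ∈ Finset.range (n + 1), c k) := by
  induction n, hmn using Nat.le_induction with
  | base =>
    rw [mul_left_comm, Finset.mul_sum (a := K)]
    gcongr with k
    exact hK k k le_rfl
  | succ n hmn ih =>
    have hsum : ∑ k ∈ Finset.range (m + 1), c k ≤ ((m : ℝ) + 1) * (K * c (n + 1)) := by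
      have h := Finset.sum_le_card_nsmul (Finset.range (m + 1)) c (K * c (n + 1))
        fun k hk => hK k (n + 1) (by have := Finset.mem_range.mp hk; omega)
      simpa [nsmul_eq_mul] using h
    rw [Finset.sum_range_succ c (n + 1)]
    push_cast
    linarith

/-- `AMIS ⊂ AMIMS`: if a nonnegative sequence `c` is almost monotone
increasing with constant `K` (`c_m ≤ K c_n` for `m ≤ n`), then its Cesàro means
`C_n = (1/(n+1)) ∑_{k=0}^n c_k` are almost monotone increasing with a constant
depending only on `K`. -/
theorem AMIS_subset_AMIMS :
    ∀ K : ℝ, ∃ K' : ℝ, ∀ c : ℕ → ℝ, (∀ n, 0 ≤ c n) →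
      (∀ m n : ℕ, m ≤ n → c m ≤ K * c n) →
      ∀ m n : ℕ, m ≤ n →
        (1 / ((m : ℝ) + 1)) * ∑ k ∈ Finset.range (m + 1), c k ≤
          K' * ((1 / ((n : ℝ) + 1)) * ∑ k ∈ Finset.range (n + 1), c k) := by
  intro K
  refine ⟨K, fun c _ hK m n hmn => ?_⟩
  have h := succ_mul_sum_le_of_almost_monotone hK hmn
  rw [one_div_mul_eq_div, one_div_mul_eq_div, ← mul_div_assoc,
    div_le_div_iff₀ (by positivity) (by positivity)]
  linarith
end

section
/- Let (a_{n,k}) be a lower triangular infinite matrix with a_{n,k} ≥ 0 for k ≤ n, a_{n,k} = 0 for k > n, and ∑_{k=0}^n a_{n,k} = 1 for every n. If either the rows (a_{n,k})_{k=0}^n belong to AMIMS with a constant independent of n, or the rows belong to AMDMS with a constant independent of n and (n+1)a_{n,0} = O(1), then for every 0 < α < 1 one has ∑_{k=0}^n (k+1)^{−α} a_{n,k} = O((n+1)^{−α}). -/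
open MeasureTheory Finset Real

/-- Abel summation: if every partial sum of `d` is nonnegative and `f` is antitone, then
`∑ f k * d k` dominates `f n * ∑ d k`. -/
lemma mul_sum_le_sum_mul_of_antitone {f d : ℕ → ℝ} (hf : Antitone f) (n : ℕ)
    (hd : ∀ m ≤ n, 0 ≤ ∑ k ∈ Finset.range (m + 1), d k) :
    f n * ∑ k ∈ Finset.range (n + 1), d k ≤ ∑ k ∈ Finset.range (n + 1), f k * d k := by
  induction n with
  | zero => simp
  | succ n ih =>
    rw [Finset.sum_range_succ _ (n + 1), Finset.sum_range_succ _ (n + 1), mul_add]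
    have h := mul_le_mul_of_nonneg_right (hf n.le_succ) (hd n n.le_succ)
    linarith [ih fun m hm => hd m (hm.trans n.le_succ)]

/-- A nonnegative antitone weight preserves the domination of partial sums. -/
lemma sum_mul_le_sum_mul_of_antitone {f b c : ℕ → ℝ} (hf : Antitone f) (n : ℕ) (hfn : 0 ≤ f n)
    (h : ∀ m ≤ n, ∑ k ∈ Finset.range (m + 1), b k ≤ ∑ k ∈ Finset.range (m + 1), c k) :
    ∑ k ∈ Finset.range (n + 1), f k * b k ≤ ∑ k ∈ Finset.range (n + 1), f k * c k := by
  have hd : ∀ m ≤ n, 0 ≤ ∑ k ∈ Finset.range (m + 1), (c k - b k) := fun m hm => by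
    rw [Finset.sum_sub_distrib]
    exact sub_nonneg.2 (h m hm)
  have key := mul_sum_le_sum_mul_of_antitone hf n hd
  have h0 := mul_nonneg hfn (hd n le_rfl)
  simp only [mul_sub, Finset.sum_sub_distrib] at key h0
  linarith

lemma antitone_add_one_rpow_neg {α : ℝ} (hα : 0 ≤ α) :
    Antitone fun k : ℕ => ((k : ℝ) + 1) ^ (-α) := fun k l hkl =>
  Real.rpow_le_rpow_of_nonpos (by positivity) (by gcongr) (neg_nonpos.2 hα)

lemma mul_add_one_rpow_neg_le_rpow_sub_rpow {α : ℝ} (hα0 : 0 ≤ α) (hα1 : α ≤ 1) (n : ℕ) :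
    (1 - α) * ((n : ℝ) + 1) ^ (-α) ≤ ((n : ℝ) + 1) ^ (1 - α) - (n : ℝ) ^ (1 - α) := by
  have hn : (0 : ℝ) < (n : ℝ) + 1 := by positivity
  have hle : 1 / ((n : ℝ) + 1) ≤ 1 := (div_le_one hn).2 (by linarith [n.cast_nonneg (α := ℝ)])
  have hb := rpow_one_add_le_one_add_mul_self (s := -(1 / ((n : ℝ) + 1))) (p := 1 - α)
    (by linarith) (by linarith) (by linarith)
  have hsplit : (n : ℝ) = ((n : ℝ) + 1) * (1 + -(1 / ((n : ℝ) + 1))) := by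
    field_simp
    ring
  have hpow : (n : ℝ) ^ (1 - α)
      = ((n : ℝ) + 1) ^ (1 - α) * (1 + -(1 / ((n : ℝ) + 1))) ^ (1 - α) := by
    rw [← Real.mul_rpow hn.le (by linarith), ← hsplit]
  have hone : ((n : ℝ) + 1) ^ (-α) = ((n : ℝ) + 1) ^ (1 - α) * (1 / ((n : ℝ) + 1)) := by
    rw [show -α = (1 - α) - 1 by ring, Real.rpow_sub_one hn.ne', mul_one_div]
  have := mul_le_mul_of_nonneg_left hb (Real.rpow_nonneg hn.le (1 - α))
  rw [hpow, hone]
  linarith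

lemma mul_sum_add_one_rpow_neg_le {α : ℝ} (hα0 : 0 ≤ α) (hα1 : α < 1) (n : ℕ) :
    (1 - α) * ∑ k ∈ Finset.range n, ((k : ℝ) + 1) ^ (-α) ≤ (n : ℝ) ^ (1 - α) := by
  induction n with
  | zero => simp [Real.zero_rpow (sub_pos.2 hα1).ne']
  | succ n ih =>
    rw [Finset.sum_range_succ, mul_add]
    push_cast
    linarith [mul_add_one_rpow_neg_le_rpow_sub_rpow hα0 hα1.le n]

/-- If the means of a finite sequence are bounded by `L / (n + 1)`, then its sum with weights
`(k + 1) ^ (-α)` is at most `L / (1 - α) * (n + 1) ^ (-α)`. -/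
lemma sum_add_one_rpow_neg_mul_le {α L : ℝ} (hα0 : 0 ≤ α) (hα1 : α < 1) (hL : 0 ≤ L)
    {b : ℕ → ℝ} {n : ℕ} (hb : ∀ m ≤ n,
      (1 / ((m : ℝ) + 1)) * ∑ k ∈ Finset.range (m + 1), b k ≤ L / ((n : ℝ) + 1)) :
    ∑ k ∈ Finset.range (n + 1), ((k : ℝ) + 1) ^ (-α) * b k
      ≤ L / (1 - α) * ((n : ℝ) + 1) ^ (-α) := by
  have hn : (0 : ℝ) < (n : ℝ) + 1 := by positivity
  have hα : 0 < 1 - α := sub_pos.2 hα1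
  have hpartial : ∀ m ≤ n, ∑ k ∈ Finset.range (m + 1), b k
      ≤ ∑ _k ∈ Finset.range (m + 1), L / ((n : ℝ) + 1) := fun m hm => by
    have h := hb m hm
    rw [one_div_mul_eq_div, div_le_iff₀ (by positivity)] at h
    rw [Finset.sum_const, Finset.card_range, nsmul_eq_mul]
    push_cast
    linarith
  have hsum := mul_sum_add_one_rpow_neg_le hα0 hα1 (n + 1)
  rw [← le_div_iff₀' hα] at hsum
  push_cast at hsum
  calc ∑ k ∈ Finset.range (n + 1), ((k : ℝ) + 1) ^ (-α) * b k
      ≤ ∑ k ∈ Finset.range (n + 1), ((k : ℝ) + 1) ^ (-α) * (L / ((n : ℝ) + 1)) :=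
        sum_mul_le_sum_mul_of_antitone (antitone_add_one_rpow_neg hα0) n
          (Real.rpow_nonneg hn.le _) hpartial
    _ = (∑ k ∈ Finset.range (n + 1), ((k : ℝ) + 1) ^ (-α)) * (L / ((n : ℝ) + 1)) :=
        (Finset.sum_mul ..).symm
    _ ≤ ((n : ℝ) + 1) ^ (1 - α) / (1 - α) * (L / ((n : ℝ) + 1)) := by gcongr
    _ = L / (1 - α) * ((n : ℝ) + 1) ^ (-α) := by
        rw [show -α = (1 - α) - 1 by ring, Real.rpow_sub_one hn.ne']
        field_simp

/-- Lemma 5: for a nonnegative lower triangular matrix with row sums `1`,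
if the rows are in `AMIMS` (uniformly in `n`), or in `AMDMS` (uniformly in `n`) with
`(n+1)a_{n,0} = O(1)`, then for every `0 < α < 1`,
`∑_{k=0}^n (k+1)^{-α} a_{n,k} = O((n+1)^{-α})`. -/
theorem matrix_weighted_sum_bound (a : ℕ → ℕ → ℝ)
    (hpos : ∀ n k, k ≤ n → 0 ≤ a n k)
    (hzero : ∀ n k, n < k → a n k = 0)
    (hsum : ∀ n, ∑ k ∈ Finset.range (n + 1), a n k = 1)
    (hyp : (∃ K : ℝ, ∀ n l m : ℕ, l ≤ m → m ≤ n → rowMean a n l ≤ K * rowMean a n m) ∨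
      ((∃ K : ℝ, ∀ n l m : ℕ, l ≤ m → m ≤ n → rowMean a n m ≤ K * rowMean a n l) ∧
        (∃ C : ℝ, ∀ n : ℕ, ((n : ℝ) + 1) * a n 0 ≤ C))) :
    ∀ α : ℝ, 0 < α → α < 1 →
      ∃ C : ℝ, ∀ n : ℕ,
        ∑ k ∈ Finset.range (n + 1), ((k : ℝ) + 1) ^ (-α) * a n k ≤
          C * ((n : ℝ) + 1) ^ (-α) := by
  intro α hα0 hα1
  have hlast : ∀ n, rowMean a n n = 1 / ((n : ℝ) + 1) := fun n => by
    rw [rowMean, hsum, mul_one]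
  have hfirst : ∀ n, rowMean a n 0 = a n 0 := fun n => by simp [rowMean]
  have h00 : rowMean a 0 0 = 1 := by simp [hlast]
  suffices ∃ L : ℝ, 0 ≤ L ∧ ∀ n m : ℕ, m ≤ n → rowMean a n m ≤ L / ((n : ℝ) + 1) by
    obtain ⟨L, hL, h⟩ := this
    exact ⟨L / (1 - α), fun n => sum_add_one_rpow_neg_mul_le hα0.le hα1 hL (h n)⟩
  rcases hyp with ⟨K, hK⟩ | ⟨⟨K, hK⟩, C, hC⟩
  · have hK0 := hK 0 0 0 le_rfl le_rfl
    rw [h00, mul_one] at hK0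
    refine ⟨K, by linarith, fun n m hm => ?_⟩
    simpa only [hlast, mul_one_div] using hK n m n hm le_rfl
  · have hK0 := hK 0 0 0 le_rfl le_rfl
    rw [h00, mul_one] at hK0
    have hC0 : 0 ≤ C := (mul_nonneg (by positivity) (hpos 0 0 le_rfl)).trans (hC 0)
    refine ⟨K * C, mul_nonneg (by linarith) hC0, fun n m hm => ?_⟩
    have ha : a n 0 ≤ C / ((n : ℝ) + 1) := (le_div_iff₀' (by positivity)).2 (hC n)
    calc rowMean a n m ≤ K * a n 0 := hfirst n ▸ hK n 0 m m.zero_le hm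
      _ ≤ K * (C / ((n : ℝ) + 1)) := mul_le_mul_of_nonneg_left ha (by linarith)
      _ = K * C / ((n : ℝ) + 1) := (mul_div_assoc ..).symm
end

section
/- Let f ∈ Lip(α,p) with p > 1 and 0 < α < 1, and let (a_{n,k}) be a lower triangular matrix with a_{n,k} ≥ 0 for k ≤ n, a_{n,k} = 0 for k > n, and ∑_{k=0}^n a_{n,k} = 1 for all n. If the rows (a_{n,k})_{k=0}^n belong to AMIMS with a constant independent of n, then ‖T_n(f) − f‖_{L^p} = O(n^{−α}). -/
open MeasureTheory Finset Real

/-- The normalized Lebesgue measure on a period `(0, 2π]`. -/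
noncomputable def periodMeasure : Measure ℝ :=
  ENNReal.ofReal (2 * π)⁻¹ • volume.restrict (Set.Ioc 0 (2 * π))

instance : IsProbabilityMeasure periodMeasure := by
  constructor
  have h : (0 : ℝ) < 2 * π := by positivity
  simp only [periodMeasure, Measure.smul_apply, Measure.restrict_apply_univ, Real.volume_Ioc,
    sub_zero, smul_eq_mul]
  rw [← ENNReal.ofReal_mul (by positivity), inv_mul_cancel₀ h.ne', ENNReal.ofReal_one]

lemma integral_periodMeasure {E : Type*} [NormedAddCommGroup E] [NormedSpace ℝ E] (g : ℝ → E) :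
    ∫ x, g x ∂periodMeasure = (2 * π)⁻¹ • ∫ x in (0 : ℝ)..(2 * π), g x := by
  rw [periodMeasure, integral_smul_measure, intervalIntegral.integral_of_le (by positivity),
    ENNReal.toReal_ofReal (by positivity)]

lemma integrable_periodMeasure_iff {E : Type*} [NormedAddCommGroup E] (g : ℝ → E) :
    Integrable g periodMeasure ↔ IntervalIntegrable g volume 0 (2 * π) := by
  have h : (0 : ℝ) < 2 * π := by positivity
  rw [periodMeasure, integrable_smul_measure (by simpa using h) (by simp),
    intervalIntegrable_iff_integrableOn_Ioc_of_le h.le]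
  rfl

lemma Continuous.integrable_periodMeasure {E : Type*} [NormedAddCommGroup E] {g : ℝ → E}
    (hg : Continuous g) : Integrable g periodMeasure :=
  (integrable_periodMeasure_iff g).2 (hg.intervalIntegrable _ _)

/-- The `L^p` seminorm with respect to `periodMeasure`. -/
noncomputable abbrev circNorm {E : Type*} [NormedAddCommGroup E] (p : ℝ) (g : ℝ → E) : ENNReal :=
  eLpNorm' g p periodMeasure

lemma circNorm_mono {E F : Type*} [NormedAddCommGroup E] [NormedAddCommGroup F] {p : ℝ}
    (hp : 0 ≤ p) {g : ℝ → E} {h : ℝ → F} (hgh : ∀ x, ‖g x‖ ≤ ‖h x‖) :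
    circNorm p g ≤ circNorm p h :=
  eLpNorm'_mono_ae hp (Filter.Eventually.of_forall hgh)

lemma circNorm_rpow {E : Type*} [NormedAddCommGroup E] {p : ℝ} (hp : 0 < p) {g : ℝ → E}
    (hg : Continuous g) :
    circNorm p g ^ p = ENNReal.ofReal (∫ x, ‖g x‖ ^ p ∂periodMeasure) := by
  have hc : Continuous fun x => ‖g x‖ ^ p := hg.norm.rpow_const fun _ => Or.inr hp.le
  rw [circNorm, eLpNorm', ← ENNReal.rpow_mul, one_div_mul_cancel hp.ne', ENNReal.rpow_one,
    ofReal_integral_eq_lintegral_ofReal hc.integrable_periodMeasure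
      (Filter.Eventually.of_forall fun x => by positivity)]
  refine lintegral_congr fun x => ?_
  rw [← ofReal_norm, ENNReal.ofReal_rpow_of_nonneg (norm_nonneg _) hp.le]

lemma circNorm_ne_top {E : Type*} [NormedAddCommGroup E] {p : ℝ} (hp : 0 < p) {g : ℝ → E}
    (hg : Continuous g) : circNorm p g ≠ ⊤ := by
  intro h
  have := circNorm_rpow hp hg
  rw [h, ENNReal.top_rpow_of_pos hp] at this
  exact ENNReal.ofReal_ne_top this.symm

/-- The restriction of a polynomial to the unit circle, in the angular variable. -/
noncomputable def onCircle (F : Polynomial ℂ) (x : ℝ) : ℂ := F.eval (circleMap 0 1 x)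

@[fun_prop]
lemma continuous_onCircle (F : Polynomial ℂ) : Continuous (onCircle F) :=
  F.continuous.comp (continuous_circleMap 0 1)

@[fun_prop]
lemma continuous_onCircle_re (F : Polynomial ℂ) : Continuous fun x => (onCircle F x).re :=
  Complex.continuous_re.comp (continuous_onCircle F)

lemma integral_onCircle (F : Polynomial ℂ) : ∫ x, onCircle F x ∂periodMeasure = F.eval 0 := by
  have := (F.differentiable.diffContOnCl (s := Metric.ball 0 |1|)).circleAverage
  rwa [circleAverage, ← integral_periodMeasure] at this

lemma exists_one_le_cos_rpow_sub {p : ℝ} (hp : 1 < p) (hp2 : p ≤ 2) :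
    ∃ A B : ℝ, 0 ≤ A ∧ 0 ≤ B ∧ ∀ θ : ℝ, |θ| < π / 2 → 1 ≤ A * cos θ ^ p - B * cos (p * θ) := by
  have hp0 : 0 < p := by linarith
  obtain ⟨θ₀, h1, h2⟩ : ∃ θ₀, π / 2 / p < θ₀ ∧ θ₀ < π / 2 :=
    exists_between (div_lt_self (by positivity) hp)
  have h0 : 0 < θ₀ := lt_trans (by positivity) h1
  rw [div_lt_iff₀ hp0] at h1
  have hc : cos (p * θ₀) < 0 :=
    cos_neg_of_pi_div_two_lt_of_lt (by linarith) (by nlinarith [pi_pos])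
  have hc0 : 0 < cos θ₀ := cos_pos_of_mem_Ioo ⟨by linarith, h2⟩
  have hcp : 0 < cos θ₀ ^ p := rpow_pos_of_pos hc0 p
  have hB : 0 ≤ (-cos (p * θ₀))⁻¹ := inv_nonneg.2 (by linarith)
  set B := (-cos (p * θ₀))⁻¹ with hBdef
  refine ⟨(1 + B) / cos θ₀ ^ p, B, by positivity, hB, fun θ hθ => ?_⟩
  have hpos : 0 < cos θ := cos_pos_of_mem_Ioo (abs_lt.1 hθ |>.imp (by intro h; linarith) id)
  rw [← cos_abs (p * θ), abs_mul, abs_of_pos hp0, ← cos_abs θ] at *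
  rcases le_or_gt |θ| θ₀ with h | h
  · have : cos θ₀ ^ p ≤ cos |θ| ^ p :=
      rpow_le_rpow hc0.le (cos_le_cos_of_nonneg_of_le_pi (abs_nonneg _) (by linarith) h) hp0.le
    have h3 : 1 + B ≤ (1 + B) / cos θ₀ ^ p * cos |θ| ^ p := by
      rw [div_mul_eq_mul_div, le_div_iff₀ hcp]
      gcongr
    nlinarith [cos_le_one (p * |θ|)]
  · have h3 : cos (p * |θ|) ≤ cos (p * θ₀) :=
      cos_le_cos_of_nonneg_of_le_pi (by positivity) (by nlinarith [pi_pos]) (by gcongr)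
    have h4 : B * (-cos (p * θ₀)) = 1 := inv_mul_cancel₀ (by linarith)
    have h5 : 0 ≤ (1 + B) / cos θ₀ ^ p * cos |θ| ^ p := by positivity
    nlinarith

lemma exists_norm_rpow_le_re {p : ℝ} (hp : 1 < p) (hp2 : p ≤ 2) :
    ∃ A B : ℝ, 0 ≤ A ∧ 0 ≤ B ∧
      ∀ z : ℂ, 0 < z.re → ‖z‖ ^ p ≤ A * z.re ^ p - B * (z ^ (p : ℂ)).re := by
  obtain ⟨A, B, hA, hB, h⟩ := exists_one_le_cos_rpow_sub hp hp2
  refine ⟨A, B, hA, hB, fun z hz => ?_⟩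
  have hz0 : z ≠ 0 := by rintro rfl; simp at hz
  have harg : |z.arg| < π / 2 := Complex.abs_arg_lt_pi_div_two_iff.2 (Or.inl hz)
  have hcos : 0 < cos z.arg := cos_pos_of_mem_Ioo (abs_lt.1 harg |>.imp (by intro h; linarith) id)
  have h1 := h z.arg harg
  have h2 : (z ^ (p : ℂ)).re = ‖z‖ ^ p * cos (p * z.arg) := by
    rw [Complex.cpow_ofReal_re, mul_comm z.arg]
  have h3 : z.re ^ p = ‖z‖ ^ p * cos z.arg ^ p := by
    rw [← mul_rpow (norm_nonneg _) hcos.le, Complex.norm_mul_cos_arg]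
  rw [h2, h3]
  nlinarith [rpow_nonneg (norm_nonneg z) p]

lemma re_eval_pos_of_onCircle_re_pos {F : Polynomial ℂ} (hF : ∀ x, 0 < (onCircle F x).re)
    {z : ℂ} (hz : z ∈ Metric.closedBall (0 : ℂ) 1) : 0 < (F.eval z).re := by
  have hd : Differentiable ℂ fun w => Complex.exp (-F.eval w) := by
    have := F.differentiable
    fun_prop
  obtain ⟨w, hw, hmax⟩ := (isCompact_sphere (0 : ℂ) 1).exists_isMaxOn
    (NormedSpace.sphere_nonempty.2 zero_le_one) hd.continuous.norm.continuousOn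
  have hpos : 0 < (F.eval w).re := by
    have := hF w.arg
    have hw1 : ‖w‖ = 1 := by simpa using hw
    have h2 := Complex.norm_mul_exp_arg_mul_I w
    rwa [onCircle, circleMap, zero_add, ← hw1, h2] at this
  have h1 : ‖Complex.exp (-F.eval z)‖ ≤ ‖Complex.exp (-F.eval w)‖ := by
    refine Complex.norm_le_of_forall_mem_frontier_norm_le (U := Metric.ball 0 1)
      Metric.isBounded_ball hd.diffContOnCl (fun y hy => ?_) ?_
    · rw [frontier_ball _ one_ne_zero] at hy
      exact hmax hy
    · rwa [closure_ball _ one_ne_zero]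
  rw [Complex.norm_exp, Complex.norm_exp, exp_le_exp, Complex.neg_re, Complex.neg_re] at h1
  linarith

/-- M. Riesz's inequality for conjugate functions, for polynomials with positive real part. -/
lemma exists_circNorm_le_of_re_pos {p : ℝ} (hp : 1 < p) (hp2 : p ≤ 2) :
    ∃ A : NNReal, ∀ F : Polynomial ℂ, (F.eval 0).im = 0 → (∀ x, 0 < (onCircle F x).re) →
      circNorm p (onCircle F) ≤ A * circNorm p fun x => (onCircle F x).re := by
  obtain ⟨A, B, hA, hB, h⟩ := exists_norm_rpow_le_re hp hp2
  have hp0 : 0 < p := by linarith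
  refine ⟨A.toNNReal ^ (1 / p), fun F h0 hF => ?_⟩
  have hslit : ∀ z ∈ Metric.closedBall (0 : ℂ) 1, F.eval z ∈ Complex.slitPlane := fun z hz =>
    Or.inl (re_eval_pos_of_onCircle_re_pos hF hz)
  have hd : DifferentiableOn ℂ (fun z => F.eval z ^ (p : ℂ)) (Metric.closedBall 0 1) :=
    F.differentiable.differentiableOn.cpow (differentiableOn_const _) hslit
  have hav := (hd.diffContOnCl_ball (U := Metric.closedBall 0 1) (c := 0) (R := |1|)
    (by simp)).circleAverage
  rw [circleAverage, ← integral_periodMeasure] at hav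
  have hre : (F.eval 0 ^ (p : ℂ)).re = (F.eval 0).re ^ p := by
    have hpos := re_eval_pos_of_onCircle_re_pos hF (z := 0) (by simp)
    have : F.eval 0 = ((F.eval 0).re : ℂ) := Complex.ext rfl (by simpa using h0)
    rw [this, ← Complex.ofReal_cpow (by simpa using hpos.le)]
    simp
  have hc : Continuous fun x => onCircle F x ^ (p : ℂ) :=
    (continuous_onCircle F).cpow continuous_const fun x => Or.inl (hF x)
  have hi : ∫ x, (onCircle F x ^ (p : ℂ)).re ∂periodMeasure = (F.eval 0).re ^ p := by
    rw [← hre, ← hav]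
    exact integral_re hc.integrable_periodMeasure
  have hcr : Continuous fun x => (onCircle F x).re ^ p :=
    (continuous_onCircle_re F).rpow_const fun _ => Or.inr hp0.le
  have hcn : Continuous fun x => ‖onCircle F x‖ ^ p :=
    (continuous_onCircle F).norm.rpow_const fun _ => Or.inr hp0.le
  have hi1 := hcr.integrable_periodMeasure.const_mul A
  have hi2 : Integrable (fun x => B * (onCircle F x ^ (p : ℂ)).re) periodMeasure :=
    (Complex.continuous_re.comp hc).integrable_periodMeasure.const_mul B
  have hmain : ∫ x, ‖onCircle F x‖ ^ p ∂periodMeasure ≤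
      A * ∫ x, ‖(onCircle F x).re‖ ^ p ∂periodMeasure := by
    calc ∫ x, ‖onCircle F x‖ ^ p ∂periodMeasure
        ≤ ∫ x, (A * (onCircle F x).re ^ p - B * (onCircle F x ^ (p : ℂ)).re) ∂periodMeasure :=
          integral_mono hcn.integrable_periodMeasure (hi1.sub hi2) fun x => h _ (hF x)
      _ = A * ∫ x, (onCircle F x).re ^ p ∂periodMeasure - B * (F.eval 0).re ^ p := by
          rw [integral_sub hi1 hi2, integral_const_mul, integral_const_mul, hi]
      _ ≤ A * ∫ x, (onCircle F x).re ^ p ∂periodMeasure := by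
          have := re_eval_pos_of_onCircle_re_pos hF (z := 0) (by simp)
          have : 0 ≤ B * (F.eval 0).re ^ p := by positivity
          linarith
      _ = _ := by
          congr 2
          ext x
          rw [norm_of_nonneg (hF x).le]
  rw [← ENNReal.rpow_le_rpow_iff hp0, ENNReal.mul_rpow_of_nonneg _ _ hp0.le,
    circNorm_rpow hp0 (continuous_onCircle F), circNorm_rpow hp0 (continuous_onCircle_re F),
    ← ENNReal.coe_rpow_of_nonneg _ (by positivity), ← NNReal.rpow_mul, one_div_mul_cancel hp0.ne',
    NNReal.rpow_one, ENNReal.coe_nnreal_eq, Real.coe_toNNReal _ hA, ← ENNReal.ofReal_mul hA]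
  exact ENNReal.ofReal_le_ofReal hmain

lemma onCircle_add (F G : Polynomial ℂ) (x : ℝ) :
    onCircle (F + G) x = onCircle F x + onCircle G x := Polynomial.eval_add

lemma onCircle_sub (F G : Polynomial ℂ) (x : ℝ) :
    onCircle (F - G) x = onCircle F x - onCircle G x := Polynomial.eval_sub _ _ _

lemma onCircle_C (c : ℂ) (x : ℝ) : onCircle (Polynomial.C c) x = c := Polynomial.eval_C

lemma onCircle_C_mul (c : ℂ) (F : Polynomial ℂ) (x : ℝ) :
    onCircle (Polynomial.C c * F) x = c * onCircle F x := by simp [onCircle]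

lemma onCircle_monomial (k : ℕ) (c : ℂ) (x : ℝ) :
    onCircle (Polynomial.monomial k c) x = c * circleMap 0 1 x ^ k := Polynomial.eval_monomial

lemma circNorm_add_le {E : Type*} [NormedAddCommGroup E] {p : ℝ} (hp : 1 ≤ p) {g h : ℝ → E}
    (hg : AEStronglyMeasurable g periodMeasure) (hh : AEStronglyMeasurable h periodMeasure) :
    circNorm p (fun x => g x + h x) ≤ circNorm p g + circNorm p h :=
  eLpNorm'_add_le hg hh hp

lemma circNorm_neg {E : Type*} [NormedAddCommGroup E] {p : ℝ} (g : ℝ → E) :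
    circNorm p (fun x => -g x) = circNorm p g :=
  eLpNorm'_congr_norm_ae (Filter.Eventually.of_forall fun _ => norm_neg _)

lemma circNorm_sub_le {E : Type*} [NormedAddCommGroup E] {p : ℝ} (hp : 1 ≤ p) {g h : ℝ → E}
    (hg : AEStronglyMeasurable g periodMeasure) (hh : AEStronglyMeasurable h periodMeasure) :
    circNorm p (fun x => g x - h x) ≤ circNorm p g + circNorm p h := by
  simp only [sub_eq_add_neg]
  rw [← circNorm_neg h]
  exact circNorm_add_le hp hg hh.neg

lemma circNorm_const {E : Type*} [NormedAddCommGroup E] {p : ℝ} (hp : 0 < p) (c : E) :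
    circNorm p (fun _ => c) = ‖c‖ₑ := by
  simp [circNorm, eLpNorm'_const c hp]

lemma enorm_integral_le_circNorm {E : Type*} [NormedAddCommGroup E] [NormedSpace ℝ E] {p : ℝ}
    (hp : 1 ≤ p) {g : ℝ → E} (hg : AEStronglyMeasurable g periodMeasure) :
    ‖∫ x, g x ∂periodMeasure‖ₑ ≤ circNorm p g := by
  refine (enorm_integral_le_lintegral_enorm g).trans ?_
  have := eLpNorm'_le_eLpNorm'_of_exponent_le one_pos hp periodMeasure hg
  simpa [eLpNorm'] using this

/-- Weierstrass approximation of periodic functions by real parts of polynomials on the circle. -/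
lemma exists_polynomial_re_near {g : ℝ → ℝ} (hg : Continuous g)
    (hper : Function.Periodic g (2 * π)) {ε : ℝ} (hε : 0 < ε) :
    ∃ W : Polynomial ℂ, (W.eval 0).im = 0 ∧ ∀ x, |(onCircle W x).re - g x| < ε := by
  have : Fact (0 < 2 * π) := ⟨by positivity⟩
  let G : C(AddCircle (2 * π), ℂ) :=
    ⟨fun y => (hper.lift y : ℂ), Complex.continuous_ofReal.comp (continuous_quot_lift _ hg)⟩
  have hG : ∀ x : ℝ, G (x : AddCircle (2 * π)) = (g x : ℂ) := fun x => rfl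
  have hmem : G ∈ (Submodule.span ℂ (Set.range (fourier (T := 2 * π)))).topologicalClosure := by
    rw [span_fourier_closure_eq_top]; trivial
  obtain ⟨h, hh, hdist⟩ := Metric.mem_closure_iff.1 hmem ε hε
  have key : ∀ a : ℂ, ∃ W : Polynomial ℂ, ∀ x : ℝ,
      (onCircle W x).re = (a * h (x : AddCircle (2 * π))).re := by
    clear hdist hmem hG
    induction hh using Submodule.span_induction with
    | mem h hh =>
      obtain ⟨k, rfl⟩ := hh
      intro a
      have hpi : (π : ℂ) ≠ 0 := by exact_mod_cast pi_ne_zero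
      have hexp : ∀ x : ℝ, fourier k (x : AddCircle (2 * π)) = Complex.exp (k * (x * Complex.I)) := by
        intro x
        rw [fourier_coe_apply]
        congr 1
        push_cast
        field_simp
      obtain ⟨m, rfl | rfl⟩ := Int.eq_nat_or_neg k
      · refine ⟨Polynomial.monomial m a, fun x => ?_⟩
        rw [onCircle_monomial, hexp, circleMap, zero_add, Complex.ofReal_one, one_mul,
          ← Complex.exp_nat_mul]
        simp
      · refine ⟨Polynomial.monomial m (starRingEnd ℂ a), fun x => ?_⟩
        rw [onCircle_monomial, hexp, circleMap, zero_add, Complex.ofReal_one, one_mul,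
          ← Complex.exp_nat_mul, ← Complex.conj_re (a * _), map_mul, ← Complex.exp_conj]
        simp
    | zero => exact fun a => ⟨0, fun x => by simp [onCircle]⟩
    | add h₁ h₂ _ _ ih₁ ih₂ =>
      intro a
      obtain ⟨W₁, hW₁⟩ := ih₁ a
      obtain ⟨W₂, hW₂⟩ := ih₂ a
      refine ⟨W₁ + W₂, fun x => ?_⟩
      rw [onCircle_add, Complex.add_re, hW₁, hW₂, ContinuousMap.add_apply, mul_add, Complex.add_re]
    | smul c h _ ih =>
      intro a
      obtain ⟨W, hW⟩ := ih (a * c)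
      exact ⟨W, fun x => by rw [hW, ContinuousMap.smul_apply, smul_eq_mul, mul_assoc]⟩
  obtain ⟨W, hW⟩ := key 1
  refine ⟨W - Polynomial.C ((W.eval 0).im * Complex.I), by simp, fun x => ?_⟩
  have h1 : ‖G x - h x‖ < ε := by
    rw [dist_eq_norm] at hdist
    exact (ContinuousMap.norm_coe_le_norm (G - h) x).trans_lt hdist
  rw [onCircle_sub, onCircle_C, Complex.sub_re, hW, abs_sub_comm]
  refine lt_of_le_of_lt ?_ h1
  have := Complex.abs_re_le_norm (G x - h x)
  rw [hG] at this ⊢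
  simpa using this

/-- M. Riesz's inequality at exponent `p`: the `L^p` norm of an analytic polynomial with real
constant term is controlled by that of its real part. -/
def ConjugateBound (p : ℝ) : Prop :=
  ∃ C : NNReal, ∀ F : Polynomial ℂ, (F.eval 0).im = 0 →
    circNorm p (onCircle F) ≤ C * circNorm p fun x => (onCircle F x).re

lemma onCircle_periodic (F : Polynomial ℂ) : Function.Periodic (onCircle F) (2 * π) := fun x => by
  rw [onCircle, onCircle, periodic_circleMap]

lemma conjugateBound_of_le_two {p : ℝ} (hp : 1 < p) (hp2 : p ≤ 2) : ConjugateBound p := by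
  obtain ⟨A, hA⟩ := exists_circNorm_le_of_re_pos hp hp2
  have hp0 : 0 < p := by linarith
  refine ⟨A * 3, fun F hF => ?_⟩
  set u : ℝ → ℝ := fun x => (onCircle F x).re with hu
  have huc : Continuous u := continuous_onCircle_re F
  have key : ∀ ε : NNReal, 0 < ε →
      circNorm p (onCircle F) ≤ (A * 3 : NNReal) * circNorm p u + (A * 6 : NNReal) * ε := by
    intro ε hε
    obtain ⟨W, hW0, hW⟩ := exists_polynomial_re_near (g := fun x => |u x| + 2 * ε) (by fun_prop)
      (fun x => by simp [hu, onCircle_periodic F x]) (NNReal.coe_pos.2 hε)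
    have hε' : (0 : ℝ) < ε := NNReal.coe_pos.2 hε
    have hWpos : ∀ x, 0 < (onCircle W x).re := fun x => by
      have := abs_lt.1 (hW x)
      linarith [abs_nonneg (u x)]
    have hWF : ∀ x, 0 < (onCircle (W + F) x).re := fun x => by
      have := abs_lt.1 (hW x)
      rw [onCircle_add, Complex.add_re]
      change 0 < _ + u x
      linarith [neg_abs_le (u x)]
    have hWn : circNorm p (fun x => (onCircle W x).re) ≤ circNorm p u + 3 * ε := by
      refine (circNorm_mono (h := fun x => |u x| + 3 * (ε : ℝ)) hp0.le fun x => ?_).trans ?_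
      · have := abs_lt.1 (hW x)
        rw [norm_of_nonneg (hWpos x).le, norm_of_nonneg (by positivity)]
        linarith
      · refine (circNorm_add_le hp.le (by fun_prop) (by fun_prop)).trans ?_
        rw [circNorm_const hp0, Real.enorm_eq_ofReal (by positivity)]
        gcongr
        · exact circNorm_mono hp0.le fun x => by simp
        · rw [ENNReal.ofReal_mul (by norm_num)]
          simp
    calc circNorm p (onCircle F)
        = circNorm p (fun x => onCircle (W + F) x - onCircle W x) := by
          congr 1; ext x; rw [onCircle_add]; ring
      _ ≤ circNorm p (onCircle (W + F)) + circNorm p (onCircle W) :=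
          circNorm_sub_le hp.le (by fun_prop) (by fun_prop)
      _ ≤ A * circNorm p (fun x => (onCircle (W + F) x).re)
            + A * circNorm p (fun x => (onCircle W x).re) :=
          add_le_add (hA _ (by simp [hW0, hF]) hWF) (hA _ hW0 hWpos)
      _ ≤ A * (circNorm p (fun x => (onCircle W x).re) + circNorm p u)
            + A * circNorm p (fun x => (onCircle W x).re) := by
          gcongr
          simp only [onCircle_add, Complex.add_re]
          exact circNorm_add_le hp.le (by fun_prop) (by fun_prop)
      _ ≤ A * (circNorm p u + 3 * ε + circNorm p u) + A * (circNorm p u + 3 * ε) := by gcongr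
      _ = _ := by push_cast; ring
  refine ENNReal.le_of_forall_pos_le_add fun δ hδ _ => ?_
  have hδ' : 0 < δ / (A * 6 + 1) := by positivity
  refine (key _ hδ').trans ?_
  gcongr
  rw [← ENNReal.coe_mul]
  gcongr
  rw [mul_div_assoc', div_le_iff₀ (by positivity)]
  nlinarith [δ.2]

lemma ENNReal.le_of_sq_le {X u : ENNReal} {C : NNReal} (hX : X ≠ ⊤)
    (h : X ^ 2 ≤ C * (u * X) + u ^ 2) : X ≤ (C + 1 : NNReal) * u := by
  rcases le_total X u with hle | hle
  · calc X ≤ 1 * u := by rwa [one_mul]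
      _ ≤ _ := by gcongr; simp
  · rcases eq_or_ne X 0 with rfl | h0
    · simp
    · have : X * X ≤ (C + 1 : NNReal) * u * X := by
        calc X * X = X ^ 2 := by ring
          _ ≤ C * (u * X) + u ^ 2 := h
          _ ≤ C * (u * X) + u * X := by rw [sq]; gcongr
          _ = _ := by push_cast; ring
      exact (ENNReal.mul_le_mul_iff_left h0 hX).1 this

/-- Cotlar's doubling argument. -/
lemma ConjugateBound.mul_two {p : ℝ} (hp : 1 < p) (h : ConjugateBound p) :
    ConjugateBound (p * 2) := by
  obtain ⟨C, hC⟩ := h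
  have hp0 : 0 < p := by linarith
  refine ⟨C * 2 + 1, fun F hF => ENNReal.le_of_sq_le (circNorm_ne_top (by linarith) (by fun_prop)) ?_⟩
  set u : ℝ → ℝ := fun x => (onCircle F x).re with hu
  set v : ℝ → ℝ := fun x => (onCircle F x).im with hv
  have huc : Continuous u := continuous_onCircle_re F
  have hvc : Continuous v := Complex.continuous_im.comp (continuous_onCircle F)
  have h0 : F.eval 0 = ((F.eval 0).re : ℂ) := Complex.ext rfl (by simpa using hF)
  set c := (F.eval 0).re with hc
  let G : Polynomial ℂ := Polynomial.C (-Complex.I) * F ^ 2 + Polynomial.C (Complex.I * c ^ 2)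
  have hG0 : (G.eval 0).im = 0 := by simp [G, h0]
  have hGx : ∀ x, onCircle G x = -Complex.I * onCircle F x ^ 2 + Complex.I * c ^ 2 := fun x => by
    simp [G, onCircle]
  have hGre : ∀ x, (onCircle G x).re = 2 * u x * v x := fun x => by
    rw [hGx]
    simp [sq, hu, hv, ← Complex.ofReal_mul]
    ring
  have hsq : circNorm (p * 2) (onCircle F) ^ 2 = circNorm p fun x => onCircle F x ^ 2 := by
    have := eLpNorm'_norm_rpow (μ := periodMeasure) (onCircle F) p 2 two_pos
    rw [← ENNReal.rpow_two, circNorm, ← this]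
    exact eLpNorm'_congr_norm_ae (Filter.Eventually.of_forall fun x => by simp)
  have hcn : ‖c‖ₑ ≤ circNorm (p * 2) u := by
    refine le_trans (le_of_eq ?_) (enorm_integral_le_circNorm (by linarith)
      huc.aestronglyMeasurable)
    congr 1
    rw [hc, ← integral_onCircle]
    exact (integral_re (continuous_onCircle F).integrable_periodMeasure).symm
  calc circNorm (p * 2) (onCircle F) ^ 2
      = circNorm p fun x => onCircle F x ^ 2 := hsq
    _ ≤ circNorm p (fun x => onCircle G x - Complex.I * c ^ 2) :=
        circNorm_mono hp0.le fun x => by rw [hGx]; simp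
    _ ≤ circNorm p (onCircle G) + circNorm p (fun _ => Complex.I * (c : ℂ) ^ 2) :=
        circNorm_sub_le hp.le (by fun_prop) (by fun_prop)
    _ ≤ C * circNorm p (fun x => 2 * u x * v x) + ‖c‖ₑ ^ 2 := by
        gcongr
        · simpa only [hGre] using hC G hG0
        · rw [circNorm_const hp0, ← ofReal_norm, ← ofReal_norm, ← ENNReal.ofReal_pow (by simp)]
          simp
    _ ≤ C * ((2 : NNReal) * circNorm (p * 2) u * circNorm (p * 2) v)
          + circNorm (p * 2) u ^ 2 := by
        gcongr
        refine eLpNorm'_le_eLpNorm'_mul_eLpNorm' huc.aestronglyMeasurable hvc.aestronglyMeasurable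
          (fun a b => 2 * a * b) 2 (Filter.Eventually.of_forall fun x => ?_) hp0 (by linarith) ?_
        · simp
        · field_simp; norm_num
    _ ≤ C * ((2 : NNReal) * circNorm (p * 2) u * circNorm (p * 2) (onCircle F))
          + circNorm (p * 2) u ^ 2 := by
        gcongr
        exact circNorm_mono (by linarith) fun x => Complex.abs_im_le_norm _
    _ = _ := by push_cast; ring

theorem conjugateBound {p : ℝ} (hp : 1 < p) : ConjugateBound p := by
  obtain ⟨n, hn⟩ := pow_unbounded_of_one_lt p one_lt_two
  induction n generalizing p with
  | zero => simp at hn; linarith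
  | succ n ih =>
    rcases le_or_gt p 2 with h | h
    · exact conjugateBound_of_le_two hp h
    · have := (ih (p := p / 2) (by linarith) (by rw [pow_succ] at hn; linarith)).mul_two (by linarith)
      rwa [div_mul_cancel₀ _ two_ne_zero] at this

/-- Uniform `L^p` boundedness of the partial sums of analytic polynomials. -/
theorem exists_circNorm_partialSum_le {p : ℝ} (hp : 1 < p) :
    ∃ C : NNReal, ∀ (d : ℕ → ℂ) (n N : ℕ), n ≤ N →
      circNorm p (onCircle (∑ k ∈ range (n + 1), Polynomial.monomial k (d k))) ≤
        C * circNorm p (onCircle (∑ k ∈ range (N + 1), Polynomial.monomial k (d k))) := by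
  obtain ⟨C, hC⟩ := conjugateBound hp
  have hp0 : 0 < p := by linarith
  refine ⟨C + C + 1, fun d n N hnN => ?_⟩
  set F : Polynomial ℂ := ∑ k ∈ range (N + 1), Polynomial.monomial k (d k) with hF
  let A : Polynomial ℂ := ∑ k ∈ Ico (n + 1) (N + 1), Polynomial.monomial (k - n) (d k)
  let B : Polynomial ℂ := ∑ k ∈ range (n + 1), Polynomial.monomial (n - k) (starRingEnd ℂ (d k))
  have hz : ∀ x, starRingEnd ℂ (circleMap 0 1 x) * circleMap 0 1 x = 1 := fun x => by
    rw [Complex.conj_mul', norm_circleMap_zero]; simp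
  have hsum : ∀ (s : Finset ℕ) (g : ℕ → ℕ) (c : ℕ → ℂ) (x : ℝ),
      onCircle (∑ k ∈ s, Polynomial.monomial (g k) (c k)) x =
        ∑ k ∈ s, c k * circleMap 0 1 x ^ g k := fun s g c x => by
    simp [onCircle, Polynomial.eval_finsetSum]
  have htr : ∀ x, onCircle (∑ k ∈ range (n + 1), Polynomial.monomial k (d k)) x =
      circleMap 0 1 x ^ n * starRingEnd ℂ (onCircle B x) := fun x => by
    rw [hsum _ (fun k => k), hsum, map_sum, mul_sum]
    refine sum_congr rfl fun k hk => ?_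
    have hk : k ≤ n := by simpa [Nat.lt_succ_iff] using hk
    rw [map_mul, map_pow, Complex.conj_conj]
    have hpow := pow_add (circleMap 0 1 x) (n - k) k
    rw [Nat.sub_add_cancel hk] at hpow
    rw [hpow]
    calc _ = d k * (circleMap 0 1 x ^ k * 1 ^ (n - k)) := by simp
      _ = _ := by rw [← hz x, mul_pow]; ring
  have hFx : ∀ x, onCircle F x =
      circleMap 0 1 x ^ n * (onCircle A x + starRingEnd ℂ (onCircle B x)) := fun x => by
    rw [mul_add, ← htr, hF, ← sum_range_add_sum_Ico _ (show n + 1 ≤ N + 1 by lia), onCircle_add,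
      add_comm, hsum _ (fun k => k), hsum _ (fun k => k - n), mul_sum]
    congr 1
    refine sum_congr rfl fun k hk => ?_
    have hk : n ≤ k := by simp at hk; lia
    have hpow := pow_add (circleMap 0 1 x) (k - n) n
    rw [Nat.sub_add_cancel hk] at hpow
    rw [hpow]; ring
  have hnorm : ∀ x, ‖circleMap 0 1 x ^ n‖ = 1 := fun x => by simp
  have hFn : ∀ x, ‖onCircle A x + starRingEnd ℂ (onCircle B x)‖ = ‖onCircle F x‖ := fun x => by
    rw [hFx, norm_mul, hnorm, one_mul]
  have hA0 : A.eval 0 = 0 := by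
    simp only [A, Polynomial.eval_finsetSum, Polynomial.eval_monomial]
    refine sum_eq_zero fun k hk => ?_
    have : k - n ≠ 0 := by simp at hk; lia
    simp [this]
  set b := B.eval 0 with hb
  let U : Polynomial ℂ := A + B - Polynomial.C (b.im * Complex.I)
  let V : Polynomial ℂ := Polynomial.C (-Complex.I) * (A - B) - Polynomial.C (b.re * Complex.I)
  have hUx : ∀ x, onCircle U x = onCircle A x + onCircle B x - b.im * Complex.I := fun x => by
    simp only [U, onCircle_add, onCircle_sub, onCircle_C]
  have hVx : ∀ x, onCircle V x = -Complex.I * (onCircle A x - onCircle B x) - b.re * Complex.I :=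
    fun x => by simp only [V, onCircle_C_mul, onCircle_sub, onCircle_C]
  have hU : circNorm p (onCircle U) ≤ C * circNorm p (onCircle F) := by
    refine (hC U (by simp [U, hA0, ← hb])).trans ?_
    gcongr
    refine circNorm_mono hp0.le fun x => ?_
    rw [← hFn]
    refine le_trans (le_of_eq ?_) (Complex.abs_re_le_norm _)
    rw [hUx]; simp
  have hV : circNorm p (onCircle V) ≤ C * circNorm p (onCircle F) := by
    refine (hC V (by simp [V, hA0, ← hb])).trans ?_
    gcongr
    refine circNorm_mono hp0.le fun x => ?_
    rw [← hFn]
    refine le_trans (le_of_eq ?_) (Complex.abs_im_le_norm _)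
    rw [hVx]; simp [sub_eq_add_neg]
  have hcB : Continuous fun x => starRingEnd ℂ (onCircle B x) :=
    Complex.continuous_conj.comp (continuous_onCircle B)
  have hbn : ‖b‖ₑ ≤ circNorm p (onCircle F) := by
    have h1 : ∫ x, (onCircle A x + starRingEnd ℂ (onCircle B x)) ∂periodMeasure
        = starRingEnd ℂ b := by
      rw [integral_add (continuous_onCircle A).integrable_periodMeasure
        hcB.integrable_periodMeasure, integral_conj, integral_onCircle, integral_onCircle, hA0,
        zero_add]
    have h2 := enorm_integral_le_circNorm (p := p) hp.le
      (g := fun x => onCircle A x + starRingEnd ℂ (onCircle B x))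
      ((continuous_onCircle A).add hcB).aestronglyMeasurable
    rw [h1] at h2
    calc ‖b‖ₑ = ‖starRingEnd ℂ b‖ₑ := by rw [← ofReal_norm, ← ofReal_norm, RCLike.norm_conj]
      _ ≤ _ := h2
      _ ≤ _ := circNorm_mono hp0.le fun x => (hFn x).le
  calc circNorm p (onCircle (∑ k ∈ range (n + 1), Polynomial.monomial k (d k)))
      ≤ circNorm p (fun x => onCircle U x - Complex.I * onCircle V x + b) := by
        refine circNorm_mono hp0.le fun x => ?_
        have h2 : onCircle U x - Complex.I * onCircle V x + b = 2 * onCircle B x := by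
          rw [hUx, hVx]
          have := Complex.re_add_im b
          linear_combination (onCircle A x - onCircle B x + b.re) * Complex.I_sq - this
        rw [htr, h2, norm_mul, hnorm, RCLike.norm_conj, norm_mul, one_mul]
        simp only [Complex.norm_ofNat]
        linarith [norm_nonneg (onCircle B x)]
    _ ≤ circNorm p (fun x => onCircle U x - Complex.I * onCircle V x) + circNorm p (fun _ => b) :=
        circNorm_add_le hp.le (by fun_prop) (by fun_prop)
    _ ≤ circNorm p (onCircle U) + circNorm p (fun x => Complex.I * onCircle V x)
          + circNorm p (fun _ => b) := by
        gcongr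
        exact circNorm_sub_le hp.le (by fun_prop) (by fun_prop)
    _ ≤ circNorm p (onCircle U) + circNorm p (onCircle V) + ‖b‖ₑ := by
        rw [circNorm_const hp0]
        gcongr
        exact circNorm_mono hp0.le fun x => by simp
    _ ≤ C * circNorm p (onCircle F) + C * circNorm p (onCircle F) + circNorm p (onCircle F) := by
        gcongr
    _ = _ := by push_cast; ring

lemma dirichletKernel_succ (n : ℕ) (u : ℝ) :
    dirichletKernel (n + 1) u = dirichletKernel n u + cos ((n + 1 : ℕ) * u) := by
  rw [dirichletKernel, dirichletKernel, sum_Icc_succ_top (by lia), add_assoc]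

@[fun_prop]
lemma continuous_dirichletKernel (n : ℕ) : Continuous (dirichletKernel n) := by
  unfold dirichletKernel; fun_prop

lemma dirichletKernel_neg (n : ℕ) (u : ℝ) : dirichletKernel n (-u) = dirichletKernel n u := by
  simp [dirichletKernel]

lemma dirichletKernel_periodic (n : ℕ) : Function.Periodic (dirichletKernel n) (2 * π) := fun u => by
  simp only [dirichletKernel]
  congr 1
  refine sum_congr rfl fun k _ => ?_
  rw [mul_add, cos_add_nat_mul_two_pi]

lemma abs_dirichletKernel_le (n : ℕ) (u : ℝ) : |dirichletKernel n u| ≤ n + 1 / 2 := by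
  induction n with
  | zero => simp [dirichletKernel, abs_of_nonneg]
  | succ n ih =>
    rw [dirichletKernel_succ]
    refine (abs_add_le _ _).trans ?_
    push_cast
    have := abs_cos_le_one (((n : ℝ) + 1) * u)
    linarith

lemma two_sin_mul_dirichletKernel (n : ℕ) (u : ℝ) :
    2 * sin (u / 2) * dirichletKernel n u = sin ((n + 1 / 2) * u) := by
  induction n with
  | zero => simp [dirichletKernel]; ring_nf
  | succ n ih =>
    rw [dirichletKernel_succ, mul_add, ih]
    have h1 : ((n : ℝ) + 1 / 2) * u = (n + 1 : ℕ) * u - u / 2 := by push_cast; ring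
    have h2 : (((n + 1 : ℕ) : ℝ) + 1 / 2) * u = (n + 1 : ℕ) * u + u / 2 := by ring
    rw [h1, h2, sin_sub, sin_add]
    ring

/-- The unnormalized Fejér kernel. -/
noncomputable def fejerSum (N : ℕ) (u : ℝ) : ℝ := ∑ k ∈ range (N + 1), dirichletKernel k u

@[fun_prop]
lemma continuous_fejerSum (N : ℕ) : Continuous (fejerSum N) := by
  unfold fejerSum; fun_prop

lemma fejerSum_neg (N : ℕ) (u : ℝ) : fejerSum N (-u) = fejerSum N u := by
  simp [fejerSum, dirichletKernel_neg]

lemma fejerSum_periodic (N : ℕ) : Function.Periodic (fejerSum N) (2 * π) := fun u => by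
  simp only [fejerSum, dirichletKernel_periodic _ u]

lemma four_sin_sq_mul_fejerSum (N : ℕ) (u : ℝ) :
    4 * sin (u / 2) ^ 2 * fejerSum N u = 1 - cos ((N + 1) * u) := by
  induction N with
  | zero =>
    simp [fejerSum, dirichletKernel]
    have := cos_sq_add_sin_sq (u / 2)
    have h2 := cos_two_mul (u / 2)
    rw [mul_div_cancel₀ _ (two_ne_zero)] at h2
    linarith
  | succ N ih =>
    rw [fejerSum, sum_range_succ, mul_add]
    change 4 * sin (u / 2) ^ 2 * fejerSum N u + _ = _
    have h := two_sin_mul_dirichletKernel (N + 1) u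
    have h1 : ((N : ℝ) + 1) * u = ((N + 1 : ℕ) + 1 / 2) * u - u / 2 := by push_cast; ring
    have h2 : (((N + 1 : ℕ) : ℝ) + 1) * u = ((N + 1 : ℕ) + 1 / 2) * u + u / 2 := by ring
    rw [ih, h1, h2, cos_sub, cos_add]
    linear_combination 2 * sin (u / 2) * h

lemma fejerSum_nonneg (N : ℕ) (u : ℝ) : 0 ≤ fejerSum N u := by
  rcases eq_or_ne (sin (u / 2)) 0 with h | h
  · obtain ⟨m, hm⟩ := sin_eq_zero_iff.1 h
    refine sum_nonneg fun k _ => ?_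
    rw [dirichletKernel]
    refine add_nonneg (by norm_num) (sum_nonneg fun j _ => ?_)
    have : (j : ℝ) * u = ((j * m : ℤ) : ℝ) * (2 * π) := by push_cast; linear_combination -2 * j * hm
    rw [this, cos_int_mul_two_pi]
    exact zero_le_one
  · have h1 := four_sin_sq_mul_fejerSum N u
    have h2 : 0 < 4 * sin (u / 2) ^ 2 := by positivity
    refine nonneg_of_mul_nonneg_right ?_ h2
    rw [h1]
    linarith [cos_le_one ((N + 1) * u)]

lemma fejerSum_le_sq (N : ℕ) (u : ℝ) : fejerSum N u ≤ ((N : ℝ) + 1) ^ 2 := by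
  calc fejerSum N u ≤ ∑ _k ∈ range (N + 1), ((N : ℝ) + 1) := by
        refine sum_le_sum fun k hk => ?_
        have : (k : ℝ) ≤ N := by
          have := mem_range.1 hk
          exact_mod_cast (by lia : k ≤ N)
        linarith [le_abs_self (dirichletKernel k u), abs_dirichletKernel_le k u]
    _ = _ := by simp only [sum_const, card_range, nsmul_eq_mul]; push_cast; ring

lemma fejerSum_le_div_sq (N : ℕ) {u : ℝ} (h0 : 0 < u) (hu : u ≤ π) :
    fejerSum N u ≤ π ^ 2 / 2 * u ^ (-2 : ℝ) := by
  have h1 := four_sin_sq_mul_fejerSum N u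
  have h2 : 2 / π * (u / 2) ≤ sin (u / 2) := mul_le_sin (by linarith) (by linarith)
  have h3 : u / π ≤ sin (u / 2) := by convert h2 using 1; ring
  have h4 : (u / π) ^ 2 ≤ sin (u / 2) ^ 2 := pow_le_pow_left₀ (by positivity) h3 2
  have h5 : 4 * (u / π) ^ 2 * fejerSum N u ≤ 2 := by
    calc _ ≤ 4 * sin (u / 2) ^ 2 * fejerSum N u := by
          gcongr
          exact fejerSum_nonneg N u
      _ ≤ 2 := by linarith [neg_one_le_cos ((N + 1) * u)]
  rw [rpow_neg h0.le, rpow_two, ← div_eq_mul_inv, le_div_iff₀ (by positivity)]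
  rw [div_pow] at h5
  have hpi : (0 : ℝ) < π ^ 2 := by positivity
  have h6 : 4 * (u ^ 2 / π ^ 2) * fejerSum N u = 4 * (fejerSum N u * u ^ 2) / π ^ 2 := by ring
  rw [h6, div_le_iff₀ hpi] at h5
  linarith

lemma integral_fejerSum_mul_rpow_le {α : ℝ} (h0 : 0 < α) (h1 : α < 1) (N : ℕ) :
    ∫ s in (0 : ℝ)..π, fejerSum N s * s ^ α ≤
      (1 + π ^ 2 / 2 / (1 - α)) * ((N : ℝ) + 1) ^ (1 - α) := by
  have hN : (0 : ℝ) < N + 1 := by positivity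
  set δ : ℝ := ((N : ℝ) + 1)⁻¹ with hδ
  have hδ0 : 0 < δ := by positivity
  have hδ1 : δ ≤ 1 := inv_le_one_of_one_le₀ (by linarith [(Nat.cast_nonneg N : (0 : ℝ) ≤ N)])
  have hδπ : δ ≤ π := hδ1.trans (by linarith [pi_gt_three])
  have hδα : δ ^ (α - 1) = ((N : ℝ) + 1) ^ (1 - α) := by
    rw [hδ, inv_rpow hN.le, ← rpow_neg hN.le]; congr 1; ring
  have hc : Continuous fun s => fejerSum N s * s ^ α :=
    (continuous_fejerSum N).mul (continuous_id.rpow_const fun _ => Or.inr h0.le)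
  rw [← intervalIntegral.integral_add_adjacent_intervals (hc.intervalIntegrable 0 δ)
    (hc.intervalIntegrable δ π), ← hδα, add_mul]
  gcongr
  · calc ∫ s in (0 : ℝ)..δ, fejerSum N s * s ^ α
        ≤ ∫ s in (0 : ℝ)..δ, ((N : ℝ) + 1) ^ 2 * s ^ α := by
          refine intervalIntegral.integral_mono_on hδ0.le (hc.intervalIntegrable _ _)
            ((intervalIntegral.intervalIntegrable_rpow (Or.inl h0.le)).const_mul _) fun s hs => ?_
          have := rpow_nonneg hs.1 α
          gcongr
          exact fejerSum_le_sq N s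
      _ = ((N : ℝ) + 1) ^ 2 * (δ ^ (α + 1) / (α + 1)) := by
          rw [intervalIntegral.integral_const_mul, integral_rpow (Or.inl (by linarith)),
            zero_rpow (by linarith), sub_zero]
      _ ≤ ((N : ℝ) + 1) ^ 2 * δ ^ (α + 1) := by
          gcongr
          exact div_le_self (by positivity) (by linarith)
      _ = 1 * δ ^ (α - 1) := by
          have : δ ^ (α + 1) = δ ^ (α - 1) * δ ^ 2 := by
            rw [← rpow_two, ← rpow_add hδ0]; congr 1; ring
          rw [this, hδ]
          field_simp
  · have hi : IntervalIntegrable (fun s : ℝ => s ^ (α - 2)) volume δ π :=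
      intervalIntegral.intervalIntegrable_rpow (Or.inr (by
        rw [Set.uIcc_of_le hδπ]; exact fun h => absurd h.1 (by linarith)))
    calc ∫ s in δ..π, fejerSum N s * s ^ α
        ≤ ∫ s in δ..π, π ^ 2 / 2 * s ^ (α - 2) := by
          refine intervalIntegral.integral_mono_on hδπ (hc.intervalIntegrable _ _)
            (hi.const_mul _) fun s hs => ?_
          have hs0 : 0 < s := hδ0.trans_le hs.1
          rw [sub_eq_neg_add, rpow_add hs0, ← mul_assoc]
          gcongr
          exact fejerSum_le_div_sq N hs0 hs.2
      _ = π ^ 2 / 2 * ((δ ^ (α - 1) - π ^ (α - 1)) / (1 - α)) := by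
          rw [intervalIntegral.integral_const_mul, integral_rpow (Or.inr ⟨by linarith, by
            rw [Set.uIcc_of_le hδπ]; exact fun h => absurd h.1 (by linarith)⟩),
            show α - 2 + 1 = α - 1 by ring, ← neg_div_neg_eq (π ^ (α - 1) - _),
            neg_sub, neg_sub]
      _ ≤ π ^ 2 / 2 * (δ ^ (α - 1) / (1 - α)) := by
          have := rpow_nonneg pi_pos.le (α - 1)
          have h1' : 0 < 1 - α := by linarith
          gcongr
          linarith
      _ = _ := by ring

lemma integral_fejerSum_mul_abs_rpow_le {α : ℝ} (h0 : 0 < α) (h1 : α < 1) (N : ℕ) :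
    ∫ s in (-π)..π, fejerSum N s * |s| ^ α ≤
      2 * (1 + π ^ 2 / 2 / (1 - α)) * ((N : ℝ) + 1) ^ (1 - α) := by
  have hc : Continuous fun s => fejerSum N s * |s| ^ α :=
    (continuous_fejerSum N).mul (continuous_abs.rpow_const fun _ => Or.inr h0.le)
  have hpos : ∫ s in (0 : ℝ)..π, fejerSum N s * |s| ^ α = ∫ s in (0 : ℝ)..π, fejerSum N s * s ^ α :=
    intervalIntegral.integral_congr fun s hs => by
      rw [Set.uIcc_of_le pi_pos.le] at hs
      simp only [abs_of_nonneg hs.1]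
  have hneg : ∫ s in (-π)..0, fejerSum N s * |s| ^ α = ∫ s in (0 : ℝ)..π, fejerSum N s * |s| ^ α := by
    have := intervalIntegral.integral_comp_neg (a := -π) (b := 0) fun s => fejerSum N s * |s| ^ α
    simpa [fejerSum_neg] using this
  rw [← intervalIntegral.integral_add_adjacent_intervals (hc.intervalIntegrable _ 0)
    (hc.intervalIntegrable 0 _), hneg, hpos]
  linarith [integral_fejerSum_mul_rpow_le h0 h1 N]

lemma integral_dirichletKernel (n : ℕ) : ∫ u in (0 : ℝ)..(2 * π), dirichletKernel n u = π := by
  induction n with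
  | zero => simp [dirichletKernel]; ring
  | succ n ih =>
    simp_rw [dirichletKernel_succ]
    rw [intervalIntegral.integral_add ((continuous_dirichletKernel n).intervalIntegrable _ _)
      (Continuous.intervalIntegrable (by fun_prop) _ _), ih,
      intervalIntegral.integral_comp_mul_left _ (by positivity), integral_cos,
      show ((n + 1 : ℕ) : ℝ) * (2 * π) = (2 * (n + 1) : ℕ) * π by push_cast; ring, sin_nat_mul_pi]
    simp

lemma integral_fejerSum (N : ℕ) : ∫ u in (-π)..π, fejerSum N u = π * (N + 1) := by
  have h := (fejerSum_periodic N).intervalIntegral_add_eq (-π) 0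
  rw [show -π + 2 * π = π by ring, zero_add] at h
  rw [h]
  simp only [fejerSum]
  rw [intervalIntegral.integral_finsetSum fun k _ =>
    (continuous_dirichletKernel k).intervalIntegrable _ _]
  simp [integral_dirichletKernel]
  ring

lemma lintegral_rpow_lintegral_le {X Y : Type*} [MeasurableSpace X] [MeasurableSpace Y] {p : ℝ}
    (hp : 1 < p) {μ : Measure X} {ν : Measure Y} [SFinite μ] [SFinite ν] {h : X → Y → ENNReal}
    (hh : AEMeasurable (Function.uncurry h) (μ.prod ν)) {M : ENNReal}
    (hM : ∀ᵐ s ∂ν, ∫⁻ x, h x s ^ p ∂μ ≤ M ^ p) :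
    ∫⁻ x, (∫⁻ s, h x s ∂ν) ^ p ∂μ ≤ (M * ν Set.univ) ^ p := by
  have hp0 : 0 < p := by linarith
  have hpq := Real.HolderConjugate.conjExponent hp
  set q := p.conjExponent
  have hq : 1 / q * p = p - 1 := by
    have := hpq.one_div_add_one_div
    have h2 : 1 / q = 1 - 1 / p := by linarith
    rw [h2]; field_simp
  have hpow : AEMeasurable (Function.uncurry fun x s => h x s ^ p) (μ.prod ν) := hh.pow_const p
  have hr : AEMeasurable (fun x => ∫⁻ s, h x s ^ p ∂ν) μ := hpow.lintegral_prod_right'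
  have hsec : ∀ᵐ x ∂μ, (∫⁻ s, h x s ∂ν) ^ p ≤ (∫⁻ s, h x s ^ p ∂ν) * ν Set.univ ^ (p - 1) := by
    filter_upwards [hh.aestronglyMeasurable.prodMk_left] with x hx
    have := ENNReal.lintegral_mul_le_Lp_mul_Lq ν hpq hx.aemeasurable (aemeasurable_const (b := 1))
    simp only [Pi.mul_apply, mul_one, ENNReal.one_rpow, lintegral_const, one_mul] at this
    calc (∫⁻ s, h x s ∂ν) ^ p
        ≤ ((∫⁻ s, h x s ^ p ∂ν) ^ (1 / p) * ν Set.univ ^ (1 / q)) ^ p := by gcongr; exact this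
      _ = _ := by
        rw [ENNReal.mul_rpow_of_nonneg _ _ hp0.le, ← ENNReal.rpow_mul, ← ENNReal.rpow_mul, hq,
          one_div_mul_cancel hp0.ne', ENNReal.rpow_one]
  calc ∫⁻ x, (∫⁻ s, h x s ∂ν) ^ p ∂μ
      ≤ ∫⁻ x, (∫⁻ s, h x s ^ p ∂ν) * ν Set.univ ^ (p - 1) ∂μ := lintegral_mono_ae hsec
    _ = (∫⁻ s, ∫⁻ x, h x s ^ p ∂μ ∂ν) * ν Set.univ ^ (p - 1) := by
        rw [lintegral_mul_const'' _ hr, lintegral_lintegral_swap hpow]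
    _ ≤ (∫⁻ _, M ^ p ∂ν) * ν Set.univ ^ (p - 1) := by
        gcongr 1
        exact lintegral_mono_ae hM
    _ = _ := by
        rw [lintegral_const, ENNReal.mul_rpow_of_nonneg _ _ hp0.le, mul_assoc]
        congr 1
        nth_rw 1 [← ENNReal.rpow_one (ν Set.univ)]
        rw [← ENNReal.rpow_add_of_nonneg _ _ zero_le_one (by linarith)]
        congr 1; ring

lemma lpNorm_eq_toReal_circNorm {p : ℝ} (hp : 0 < p) {g : ℝ → ℝ}
    (hg : AEStronglyMeasurable g periodMeasure) : _root_.lpNorm p g = (circNorm p g).toReal := by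
  rw [_root_.lpNorm, circNorm, eLpNorm', ← ENNReal.toReal_rpow]
  congr 1
  rw [one_div, ← smul_eq_mul, ← integral_periodMeasure, integral_eq_lintegral_of_nonneg_ae
    (Filter.Eventually.of_forall fun x => by positivity)
    (hg.aemeasurable.abs.pow_const p).aestronglyMeasurable]
  congr 1
  refine lintegral_congr fun x => ?_
  rw [← ofReal_norm, ENNReal.ofReal_rpow_of_nonneg (norm_nonneg _) hp.le, Real.norm_eq_abs]

lemma circNorm_ne_top_of_integrable {p : ℝ} (hp : 0 < p) {g : ℝ → ℝ}
    (hg : Integrable (fun x => |g x| ^ p) periodMeasure) : circNorm p g ≠ ⊤ := by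
  rw [circNorm, eLpNorm']
  refine ENNReal.rpow_ne_top_of_nonneg (by positivity) ?_
  refine ne_of_eq_of_ne (lintegral_congr fun x => ?_) hg.lintegral_lt_top.ne
  rw [← ofReal_norm, ENNReal.ofReal_rpow_of_nonneg (norm_nonneg _) hp.le, Real.norm_eq_abs]

lemma periodMeasure_absolutelyContinuous : periodMeasure ≪ volume :=
  (Measure.smul_absolutelyContinuous).trans Measure.restrict_le_self.absolutelyContinuous

lemma Function.Periodic.aestronglyMeasurable {f : ℝ → ℝ} {T : ℝ} (hT : 0 < T)
    (hper : Function.Periodic f T) (hf : IntervalIntegrable f volume 0 T) :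
    AEStronglyMeasurable f volume := by
  have : LocallyIntegrable f volume := fun x =>
    ⟨Set.Ioc (x - 1) (x + 1), Ioc_mem_nhds (by linarith) (by linarith),
      (intervalIntegrable_iff_integrableOn_Ioc_of_le (by linarith)).1
        (hper.intervalIntegrable₀ hT.ne' hf _ _)⟩
  exact this.aestronglyMeasurable

/-- The defining data of the class `Lip(α,p)` in terms of the `L^p` seminorm. -/
lemma LipClass.exists_circNorm_le {α p : ℝ} (hp : 1 < p) {f : ℝ → ℝ} (hf : LipClass α p f) :
    ∃ C : ℝ, 0 < C ∧ ∀ h : ℝ, h ≠ 0 →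
      circNorm p (fun x => f (x + h) - f x) ≤ ENNReal.ofReal (C * |h| ^ α) := by
  obtain ⟨hper, hfi, hfp, C, hC, hmod⟩ := hf
  have hp0 : 0 < p := by linarith
  have hT : (0 : ℝ) < 2 * π := by positivity
  have hm := hper.aestronglyMeasurable hT hfi
  have hms : ∀ h : ℝ, AEStronglyMeasurable (fun x => f (x + h)) periodMeasure := fun h =>
    (hm.comp_quasiMeasurePreserving
      (measurePreserving_add_right volume h).quasiMeasurePreserving).mono_ac
        periodMeasure_absolutelyContinuous
  have hm0 : AEStronglyMeasurable f periodMeasure := hm.mono_ac periodMeasure_absolutelyContinuous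
  have hmsub : ∀ h : ℝ, AEStronglyMeasurable (fun x => f (x + h) - f x) periodMeasure := fun h =>
    (hms h).sub hm0
  have hpp : Function.Periodic (fun x => |f x| ^ p) (2 * π) := fun x => by simp only [hper x]
  have hfin : ∀ h : ℝ, circNorm p (fun x => f (x + h)) ≠ ⊤ := fun h => by
    refine circNorm_ne_top_of_integrable hp0 ((integrable_periodMeasure_iff _).2 ?_)
    have := (hpp.intervalIntegrable₀ hT.ne' hfp h (2 * π + h)).comp_add_right h
    simpa using this
  have heq : ∀ h : ℝ, circNorm p (fun x => f (x + h)) = circNorm p f := fun h => by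
    have h0 := hfin 0
    simp only [add_zero] at h0
    rw [← ENNReal.toReal_eq_toReal_iff' (hfin h) h0, ← lpNorm_eq_toReal_circNorm hp0 (hms h),
      ← lpNorm_eq_toReal_circNorm hp0 hm0, _root_.lpNorm, _root_.lpNorm]
    congr 2
    have h1 := intervalIntegral.integral_comp_add_right (a := 0) (b := 2 * π)
      (fun x => |f x| ^ p) h
    have h2 := hpp.intervalIntegral_add_eq h 0
    rw [h1, zero_add, add_comm (2 * π), h2, zero_add]
  have hf0 : circNorm p f ≠ ⊤ := heq 0 ▸ hfin 0
  have hle : ∀ h : ℝ, circNorm p (fun x => f (x + h) - f x) ≤ circNorm p f + circNorm p f := fun h =>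
    (circNorm_sub_le hp.le (hms h) hm0).trans (by rw [heq])
  have htop : circNorm p f + circNorm p f ≠ ⊤ := ENNReal.add_ne_top.2 ⟨hf0, hf0⟩
  refine ⟨C, hC, fun h hh => ?_⟩
  have habs := abs_pos.2 hh
  rw [ENNReal.le_ofReal_iff_toReal_le (ne_top_of_le_ne_top htop (hle h)) (by positivity),
    ← lpNorm_eq_toReal_circNorm hp0 (hmsub h)]
  refine le_trans ?_ (hmod |h| habs)
  refine le_csSup ⟨(circNorm p f + circNorm p f).toReal, ?_⟩ ⟨h, habs, le_rfl, rfl⟩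
  rintro y ⟨k, -, -, rfl⟩
  change _root_.lpNorm p (fun x => f (x + k) - f x) ≤ _
  rw [lpNorm_eq_toReal_circNorm hp0 (hmsub k)]
  exact ENNReal.toReal_mono htop (hle k)

/-- The Fejér means of the Fourier series of `f`. -/
noncomputable def fejerMean (f : ℝ → ℝ) (N : ℕ) (x : ℝ) : ℝ :=
  ((N : ℝ) + 1)⁻¹ * ∑ k ∈ range (N + 1), partialFourierSum f k x

lemma fejerMean_sub_eq {f : ℝ → ℝ} (hper : Function.Periodic f (2 * π))
    (hfi : IntervalIntegrable f volume 0 (2 * π)) (N : ℕ) (x : ℝ) :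
    fejerMean f N x - f x =
      (π * (N + 1))⁻¹ * ∫ s in (-π)..π, (f (x - s) - f x) * fejerSum N s := by
  have hT : (0 : ℝ) < 2 * π := by positivity
  have hN : (0 : ℝ) < N + 1 := by positivity
  have hfx : ∀ a b : ℝ, IntervalIntegrable (fun t => f (x - t)) volume a b := fun a b => by
    simpa using (hper.intervalIntegrable₀ hT.ne' hfi (x - a) (x - b)).comp_sub_left x
  have hsum : ∑ k ∈ range (N + 1), partialFourierSum f k x =
      1 / π * ∫ t in (0 : ℝ)..(2 * π), f t * fejerSum N (x - t) := by
    simp only [partialFourierSum, fejerSum, mul_sum]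
    rw [intervalIntegral.integral_finsetSum fun k _ =>
      hfi.mul_continuousOn (Continuous.continuousOn (by fun_prop)), mul_sum]
  have hshift : ∫ t in (0 : ℝ)..(2 * π), f t * fejerSum N (x - t) =
      ∫ s in (-π)..π, f (x - s) * fejerSum N s := by
    have hpp : Function.Periodic (fun t => f t * fejerSum N (x - t)) (2 * π) := fun t => by
      simp only [hper t]
      rw [← (fejerSum_periodic N) (x - (t + 2 * π))]
      congr 2; ring
    have h1 := hpp.intervalIntegral_add_eq 0 (x - π)
    rw [zero_add] at h1
    rw [h1, show x - π + 2 * π = x - -π by ring,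
      ← intervalIntegral.integral_comp_sub_left (fun t => f t * fejerSum N (x - t)) x]
    simp
  have hsub : ∫ s in (-π)..π, (f (x - s) - f x) * fejerSum N s =
      (∫ s in (-π)..π, f (x - s) * fejerSum N s) - f x * (π * (N + 1)) := by
    simp only [sub_mul]
    rw [intervalIntegral.integral_sub
      ((hfx _ _).mul_continuousOn (continuous_fejerSum N).continuousOn)
      (Continuous.intervalIntegrable (by fun_prop) _ _), intervalIntegral.integral_const_mul,
      integral_fejerSum]
  rw [fejerMean, hsum, hshift, hsub]
  field_simp

/-- Fejér means approximate functions of class `Lip(α,p)`, `α < 1`, at the optimal rate. -/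
lemma exists_circNorm_fejerMean_sub_le {α p : ℝ} (hp : 1 < p) (h0 : 0 < α) (h1 : α < 1)
    {f : ℝ → ℝ} (hf : LipClass α p f) :
    ∃ C : ℝ, 0 ≤ C ∧ ∀ N : ℕ,
      circNorm p (fun x => fejerMean f N x - f x) ≤ ENNReal.ofReal (C * ((N : ℝ) + 1) ^ (-α)) := by
  obtain ⟨C, hC, hlip⟩ := hf.exists_circNorm_le hp
  obtain ⟨hper, hfi, -, -⟩ := hf
  have hp0 : 0 < p := by linarith
  have hm := hper.aestronglyMeasurable (by positivity) hfi
  have h1' : 0 < 1 - α := by linarith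
  set B := 2 * (1 + π ^ 2 / 2 / (1 - α)) with hB
  have hB0 : 0 ≤ B := by positivity
  refine ⟨π⁻¹ * C * B, by positivity, fun N => ?_⟩
  have hN : (0 : ℝ) < N + 1 := by positivity
  let ρ : ℝ → ENNReal := fun s => ENNReal.ofReal (fejerSum N s * |s| ^ α)
  have hcont : Continuous fun s => fejerSum N s * |s| ^ α :=
    (continuous_fejerSum N).mul (continuous_abs.rpow_const fun _ => Or.inr h0.le)
  have hρ : Measurable ρ := hcont.measurable.ennreal_ofReal
  let ν : Measure ℝ := (volume.restrict (Set.Ioc (-π) π)).withDensity ρ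
  have hνac : ν ≪ volume :=
    (withDensity_absolutelyContinuous _ _).trans Measure.restrict_le_self.absolutelyContinuous
  have hν : ν Set.univ ≤ ENNReal.ofReal (B * ((N : ℝ) + 1) ^ (1 - α)) := by
    rw [withDensity_apply _ MeasurableSet.univ, Measure.restrict_univ,
      ← ofReal_integral_eq_lintegral_ofReal, ← intervalIntegral.integral_of_le (by linarith [pi_pos])]
    · exact ENNReal.ofReal_le_ofReal (integral_fejerSum_mul_abs_rpow_le h0 h1 N)
    · exact hcont.integrableOn_Ioc
    · exact Filter.Eventually.of_forall fun s => mul_nonneg (fejerSum_nonneg N s) (by positivity)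
  let w : ℝ → ENNReal := fun s => ENNReal.ofReal (|s| ^ α)
  let h : ℝ → ℝ → ENNReal := fun x s => ‖f (x - s) - f x‖ₑ * (w s)⁻¹
  have hw : Measurable w :=
    ((continuous_abs.rpow_const fun _ => Or.inr h0.le).measurable).ennreal_ofReal
  have hhm : AEMeasurable (Function.uncurry h) (periodMeasure.prod ν) := by
    have hac : periodMeasure.prod ν ≪ (volume : Measure ℝ).prod volume :=
      periodMeasure_absolutelyContinuous.prod hνac
    have hsub : AEStronglyMeasurable (fun z : ℝ × ℝ => f (z.1 - z.2) - f z.1)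
        ((volume : Measure ℝ).prod volume) :=
      (hm.comp_quasiMeasurePreserving
        (quasiMeasurePreserving_sub_of_right_invariant volume volume)).sub hm.comp_fst
    exact ((hsub.mono_ac hac).enorm).mul (hw.comp measurable_snd).inv.aemeasurable
  have hM : ∀ᵐ s ∂ν, ∫⁻ x, h x s ^ p ∂periodMeasure ≤ ENNReal.ofReal C ^ p := by
    have hne : ∀ᵐ s ∂(volume : Measure ℝ), s ≠ 0 := by simp [ae_iff]
    filter_upwards [hνac.ae_le hne] with s hs
    have hs' : (0 : ℝ) < |s| ^ α := rpow_pos_of_pos (abs_pos.2 hs) α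
    have hw0 : w s ≠ 0 := by simpa [w] using hs'
    have hwt : w s ≠ ⊤ := ENNReal.ofReal_ne_top
    have hl := hlip (-s) (neg_ne_zero.2 hs)
    rw [abs_neg, ENNReal.ofReal_mul hC.le, circNorm, eLpNorm', one_div,
      ENNReal.rpow_inv_le_iff hp0, ENNReal.mul_rpow_of_nonneg _ _ hp0.le] at hl
    simp only [h, ENNReal.mul_rpow_of_nonneg _ _ hp0.le]
    rw [lintegral_mul_const' _ _ (ENNReal.rpow_ne_top_of_nonneg hp0.le (ENNReal.inv_ne_top.2 hw0)),
      ENNReal.inv_rpow, ← div_eq_mul_inv]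
    exact ENNReal.div_le_of_le_mul hl
  have hmink := lintegral_rpow_lintegral_le hp hhm hM
  have hker : ∀ x, ‖fejerMean f N x - f x‖ₑ ≤
      ENNReal.ofReal ((π * (N + 1))⁻¹) * ∫⁻ s, h x s ∂ν := fun x => by
    rw [fejerMean_sub_eq hper hfi, enorm_mul, Real.enorm_of_nonneg (by positivity),
      intervalIntegral.integral_of_le (by linarith [pi_pos])]
    gcongr
    refine (enorm_integral_le_lintegral_enorm _).trans ?_
    rw [lintegral_withDensity_eq_lintegral_mul_non_measurable _ hρ
      (Filter.Eventually.of_forall fun s => ENNReal.ofReal_lt_top)]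
    have hne : ∀ᵐ s ∂(volume : Measure ℝ), s ≠ 0 := by simp [ae_iff]
    refine lintegral_mono_ae ?_
    filter_upwards [ae_restrict_of_ae hne] with s hs
    have hs' : (0 : ℝ) < |s| ^ α := rpow_pos_of_pos (abs_pos.2 hs) α
    have hw0 : w s ≠ 0 := by simpa [w] using hs'
    have hρw : ρ s = ENNReal.ofReal (fejerSum N s) * w s :=
      ENNReal.ofReal_mul (fejerSum_nonneg N s)
    rw [enorm_mul, Real.enorm_of_nonneg (fejerSum_nonneg N s), Pi.mul_apply, hρw]
    refine le_of_eq ?_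
    calc _ = ENNReal.ofReal (fejerSum N s) * ‖f (x - s) - f x‖ₑ * (w s * (w s)⁻¹) := by
          rw [ENNReal.mul_inv_cancel hw0 ENNReal.ofReal_ne_top]; ring
      _ = _ := by simp only [h]; ring
  calc circNorm p (fun x => fejerMean f N x - f x)
      ≤ (∫⁻ x, (ENNReal.ofReal ((π * (N + 1))⁻¹) * ∫⁻ s, h x s ∂ν) ^ p ∂periodMeasure) ^ (1 / p) := by
        rw [circNorm, eLpNorm']
        gcongr with x
        exact hker x
    _ = ENNReal.ofReal ((π * (N + 1))⁻¹) *
          (∫⁻ x, (∫⁻ s, h x s ∂ν) ^ p ∂periodMeasure) ^ (1 / p) := by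
        simp only [ENNReal.mul_rpow_of_nonneg _ _ hp0.le]
        rw [lintegral_const_mul' _ _ (ENNReal.rpow_ne_top_of_nonneg hp0.le ENNReal.ofReal_ne_top),
          ENNReal.mul_rpow_of_nonneg _ _ (by positivity), ← ENNReal.rpow_mul,
          mul_one_div_cancel hp0.ne', ENNReal.rpow_one]
    _ ≤ ENNReal.ofReal ((π * (N + 1))⁻¹) * (ENNReal.ofReal C * ν Set.univ) := by
        gcongr
        rwa [one_div, ENNReal.rpow_inv_le_iff hp0]
    _ ≤ ENNReal.ofReal ((π * (N + 1))⁻¹) *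
          (ENNReal.ofReal C * ENNReal.ofReal (B * ((N : ℝ) + 1) ^ (1 - α))) := by gcongr
    _ = _ := by
        rw [← ENNReal.ofReal_mul hC.le, ← ENNReal.ofReal_mul (by positivity)]
        congr 1
        rw [sub_eq_add_neg, rpow_add hN, rpow_one]
        field_simp

/-- The complex Fourier coefficients for which the real part of `∑ c_k e^{ikx}` is the Fourier
series of `f`. -/
noncomputable def fourierC (f : ℝ → ℝ) (k : ℕ) : ℂ :=
  ⟨(if k = 0 then 1 / 2 else 1) * (1 / π * ∫ t in (0 : ℝ)..(2 * π), f t * cos (k * t)),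
    -(1 / π * ∫ t in (0 : ℝ)..(2 * π), f t * sin (k * t))⟩

/-- The `k`-th term of the Fourier series of `f`. -/
noncomputable def fourierTerm (f : ℝ → ℝ) (k : ℕ) (x : ℝ) : ℝ :=
  (fourierC f k * circleMap 0 1 x ^ k).re

@[fun_prop]
lemma continuous_fourierTerm (f : ℝ → ℝ) (k : ℕ) : Continuous (fourierTerm f k) := by
  unfold fourierTerm
  have := continuous_circleMap 0 1
  fun_prop

lemma fourierTerm_eq (f : ℝ → ℝ) (k : ℕ) (x : ℝ) :
    fourierTerm f k x = (fourierC f k).re * cos (k * x) - (fourierC f k).im * sin (k * x) := by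
  have : circleMap 0 1 x ^ k = Complex.exp (((k * x : ℝ) : ℂ) * Complex.I) := by
    rw [circleMap_zero, Complex.ofReal_one, one_mul, ← Complex.exp_nat_mul]
    congr 1; push_cast; ring
  rw [fourierTerm, this, Complex.mul_re, Complex.exp_ofReal_mul_I_re, Complex.exp_ofReal_mul_I_im]

lemma partialFourierSum_eq {f : ℝ → ℝ} (hfi : IntervalIntegrable f volume 0 (2 * π)) (n : ℕ)
    (x : ℝ) : partialFourierSum f n x = ∑ k ∈ range (n + 1), fourierTerm f k x := by
  have hmul : ∀ g : ℝ → ℝ, Continuous g →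
      IntervalIntegrable (fun t => f t * g t) volume 0 (2 * π) := fun g hg =>
    hfi.mul_continuousOn hg.continuousOn
  induction n with
  | zero =>
    simp only [partialFourierSum, dirichletKernel, zero_add, sum_range_one, fourierTerm_eq, fourierC]
    simp
    ring
  | succ n ih =>
    rw [sum_range_succ, ← ih, partialFourierSum, partialFourierSum, fourierTerm_eq]
    simp only [dirichletKernel_succ, mul_add (f _)]
    rw [intervalIntegral.integral_add (hmul _ (by fun_prop)) (hmul _ (by fun_prop)), mul_add]
    congr 1
    have : ∀ t, f t * cos ((n + 1 : ℕ) * (x - t)) =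
        cos ((n + 1 : ℕ) * x) * (f t * cos ((n + 1 : ℕ) * t)) +
          sin ((n + 1 : ℕ) * x) * (f t * sin ((n + 1 : ℕ) * t)) := fun t => by
      rw [mul_sub, cos_sub]; ring
    simp only [this]
    rw [intervalIntegral.integral_add ((hmul _ (by fun_prop)).const_mul _)
      ((hmul _ (by fun_prop)).const_mul _), intervalIntegral.integral_const_mul,
      intervalIntegral.integral_const_mul]
    simp only [fourierC, Nat.succ_ne_zero, if_false]
    ring

lemma sum_range_sum_range_succ (g : ℕ → ℝ) (N : ℕ) :
    ∑ j ∈ range (N + 1), ∑ k ∈ range (j + 1), g k =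
      ∑ k ∈ range (N + 1), ((N : ℝ) + 1 - k) * g k := by
  induction N with
  | zero => simp
  | succ N ih =>
    rw [sum_range_succ, ih, sum_range_succ _ (N + 1), sum_range_succ _ (N + 1), ← add_assoc,
      ← sum_add_distrib]
    push_cast
    congr 1
    · exact sum_congr rfl fun k _ => by ring
    · ring

lemma fejerMean_eq {f : ℝ → ℝ} (hfi : IntervalIntegrable f volume 0 (2 * π)) (N : ℕ) (x : ℝ) :
    fejerMean f N x = ∑ k ∈ range (N + 1), (1 - k / ((N : ℝ) + 1)) * fourierTerm f k x := by
  have hN : (N : ℝ) + 1 ≠ 0 := by positivity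
  simp only [fejerMean, partialFourierSum_eq hfi]
  rw [sum_range_sum_range_succ, mul_sum]
  refine sum_congr rfl fun k _ => ?_
  field_simp

/-- Truncation of real trigonometric sums is bounded on `L^p`, `p > 1`. -/
lemma exists_circNorm_truncation_le {p : ℝ} (hp : 1 < p) (f : ℝ → ℝ) :
    ∃ C : NNReal, ∀ (w : ℕ → ℝ) (n N : ℕ), n ≤ N →
      circNorm p (fun x => ∑ k ∈ range (n + 1), w k * fourierTerm f k x) ≤
        C * circNorm p (fun x => ∑ k ∈ range (N + 1), w k * fourierTerm f k x) := by
  obtain ⟨C, hC⟩ := exists_circNorm_partialSum_le hp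
  obtain ⟨D, hD⟩ := conjugateBound hp
  refine ⟨C * D, fun w n N hnN => ?_⟩
  let d : ℕ → ℂ := fun k => w k * fourierC f k
  have hre : ∀ (m : ℕ) (x : ℝ), (onCircle (∑ k ∈ range (m + 1), Polynomial.monomial k (d k)) x).re =
      ∑ k ∈ range (m + 1), w k * fourierTerm f k x := fun m x => by
    simp only [onCircle, Polynomial.eval_finsetSum, Polynomial.eval_monomial, Complex.re_sum, d,
      mul_assoc, Complex.re_ofReal_mul, fourierTerm]
  have him : ((∑ k ∈ range (N + 1), Polynomial.monomial k (d k)).eval 0).im = 0 := by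
    rw [Polynomial.eval_finsetSum, Complex.im_sum]
    refine sum_eq_zero fun k _ => ?_
    rcases eq_or_ne k 0 with rfl | hk
    · simp [d, fourierC]
    · simp [hk]
  have h1 := hC d n N hnN
  have h2 := hD _ him
  simp only [hre] at h2
  calc circNorm p (fun x => ∑ k ∈ range (n + 1), w k * fourierTerm f k x)
      ≤ circNorm p (onCircle (∑ k ∈ range (n + 1), Polynomial.monomial k (d k))) :=
        circNorm_mono (by linarith) fun x => by
          rw [← hre, Real.norm_eq_abs]; exact Complex.abs_re_le_norm _
    _ ≤ C * (D * circNorm p (fun x => ∑ k ∈ range (N + 1), w k * fourierTerm f k x)) := by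
        exact h1.trans (by gcongr)
    _ = _ := by push_cast; ring

/-- Partial Fourier sums approximate functions of class `Lip(α,p)`, `p > 1`, at the optimal rate. -/
lemma exists_circNorm_partialFourierSum_sub_le {α p : ℝ} (hp : 1 < p) (h0 : 0 < α) (h1 : α < 1)
    {f : ℝ → ℝ} (hf : LipClass α p f) :
    ∃ C : ℝ, 0 ≤ C ∧ ∀ n : ℕ, circNorm p (fun x => partialFourierSum f n x - f x) ≤
      ENNReal.ofReal (C * ((n : ℝ) + 1) ^ (-α)) := by
  obtain ⟨A, hA, hfej⟩ := exists_circNorm_fejerMean_sub_le hp h0 h1 hf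
  obtain ⟨B, hB⟩ := exists_circNorm_truncation_le hp f
  obtain ⟨hper, hfi, -, -⟩ := hf
  have hfm : AEStronglyMeasurable f periodMeasure :=
    (hper.aestronglyMeasurable (by positivity) hfi).mono_ac periodMeasure_absolutelyContinuous
  have hfejc : ∀ N, Continuous (fejerMean f N) := fun N => by
    rw [show fejerMean f N = _ from funext (fejerMean_eq hfi N)]
    fun_prop
  have hfejm : ∀ N, AEStronglyMeasurable (fun x => fejerMean f N x - f x) periodMeasure := fun N =>
    (hfejc N).aestronglyMeasurable.sub hfm
  refine ⟨B * (A + A) + A, by positivity, fun n => ?_⟩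
  set E := ENNReal.ofReal (A * ((n : ℝ) + 1) ^ (-α)) with hE
  let t : ℕ → ℝ → ℝ := fun N x => ∑ k ∈ range (n + 1), (k / ((n : ℝ) + 1) - k / ((N : ℝ) + 1)) *
    fourierTerm f k x
  have ht : ∀ N, n ≤ N → circNorm p (t N) ≤ B * (E + E) := fun N hnN => by
    let w : ℕ → ℝ := fun k => (1 - k / ((N : ℝ) + 1)) - if k < n + 1 then 1 - k / ((n : ℝ) + 1) else 0
    have hw : t N = fun x => ∑ k ∈ range (n + 1), w k * fourierTerm f k x := by
      ext x
      refine sum_congr rfl fun k hk => ?_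
      simp only [w, if_pos (mem_range.1 hk)]
      ring
    have hw' : (fun x => ∑ k ∈ range (N + 1), w k * fourierTerm f k x) =
        fun x => (fejerMean f N x - f x) - (fejerMean f n x - f x) := by
      ext x
      rw [sub_sub_sub_cancel_right, fejerMean_eq hfi, fejerMean_eq hfi]
      simp only [w, sub_mul _ _ (fourierTerm f _ x), ite_mul, zero_mul]
      rw [sum_sub_distrib, ← sum_filter]
      congr 2
      ext k
      simp
      lia
    rw [hw]
    refine (hB w n N hnN).trans ?_
    rw [hw']
    gcongr
    refine (circNorm_sub_le hp.le (hfejm N) (hfejm n)).trans ?_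
    gcongr
    · refine (hfej N).trans (ENNReal.ofReal_le_ofReal ?_)
      refine mul_le_mul_of_nonneg_left ?_ hA
      exact rpow_le_rpow_of_nonpos (by positivity) (by gcongr) (by linarith)
    · exact hfej n
  have hlim : ∀ x, Filter.Tendsto (fun N => t N x) Filter.atTop
      (nhds (partialFourierSum f n x - fejerMean f n x)) := fun x => by
    have : partialFourierSum f n x - fejerMean f n x =
        ∑ k ∈ range (n + 1), (k / ((n : ℝ) + 1) - k * 0) * fourierTerm f k x := by
      rw [partialFourierSum_eq hfi, fejerMean_eq hfi, ← sum_sub_distrib]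
      exact sum_congr rfl fun k _ => by ring
    rw [this]
    refine tendsto_finsetSum _ fun k _ => Filter.Tendsto.mul_const _ (Filter.Tendsto.const_sub _ ?_)
    simpa only [mul_one_div] using tendsto_one_div_add_atTop_nhds_zero_nat.const_mul (k : ℝ)
  have hdiff : circNorm p (fun x => partialFourierSum f n x - fejerMean f n x) ≤ B * (E + E) := by
    refine (Lp.eLpNorm'_lim_le_liminf_eLpNorm' (by linarith) (fun N => ?_)
      (Filter.Eventually.of_forall hlim)).trans ?_
    · exact Continuous.aestronglyMeasurable (by fun_prop)
    · exact Filter.liminf_le_of_le (by isBoundedDefault) fun b hb => by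
        obtain ⟨N, hN, hnN⟩ := (hb.and (Filter.eventually_ge_atTop n)).exists
        exact hN.trans (ht N hnN)
  have hpc : Continuous (partialFourierSum f n) := by
    rw [show partialFourierSum f n = _ from funext (partialFourierSum_eq hfi n)]
    fun_prop
  calc circNorm p (fun x => partialFourierSum f n x - f x)
      = circNorm p (fun x => (partialFourierSum f n x - fejerMean f n x) + (fejerMean f n x - f x)) := by
        simp only [sub_add_sub_cancel]
    _ ≤ B * (E + E) + E := (circNorm_add_le hp.le (hpc.sub (hfejc n)).aestronglyMeasurable
        (hfejm n)).trans (add_le_add hdiff (hfej n))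
    _ = _ := by
        rw [hE, ← ENNReal.ofReal_coe_nnreal, ← ENNReal.ofReal_add (by positivity) (by positivity),
          ← ENNReal.ofReal_mul (by positivity), ← ENNReal.ofReal_add (by positivity) (by positivity)]
        congr 1; ring

lemma sum_range_rpow_neg_le {α : ℝ} (h0 : 0 < α) (h1 : α < 1) (n : ℕ) :
    ∑ k ∈ range n, ((k : ℝ) + 1) ^ (-α) ≤ (n : ℝ) ^ (1 - α) / (1 - α) := by
  have hα : 0 < 1 - α := by linarith
  induction n with
  | zero => simp [zero_rpow hα.ne']
  | succ n ih =>
    have hn : (0 : ℝ) < n + 1 := by positivity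
    rw [sum_range_succ]
    refine (add_le_add_left ih _).trans ?_
    rw [le_div_iff₀ hα, add_mul, div_mul_cancel₀ _ hα.ne']
    have hb := rpow_one_add_le_one_add_mul_self (s := -1 / ((n : ℝ) + 1)) (p := 1 - α)
      (by rw [le_div_iff₀ hn]; nlinarith [(Nat.cast_nonneg n : (0 : ℝ) ≤ n)]) hα.le (by linarith)
    have he : 1 + -1 / ((n : ℝ) + 1) = n / (n + 1) := by field_simp; ring
    rw [he, div_rpow (by positivity) hn.le, div_le_iff₀ (by positivity)] at hb
    have hs : ((n : ℝ) + 1) ^ (-α) = ((n : ℝ) + 1) ^ (1 - α) / (n + 1) := by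
      rw [sub_eq_add_neg, rpow_add hn, rpow_one]; field_simp
    push_cast
    rw [hs]
    refine (add_le_add_left hb _).trans (le_of_eq ?_)
    field_simp
    ring

lemma sum_sub_mul_eq (φ : ℕ → ℝ) (n : ℕ) :
    ∑ i ∈ range n, (φ (i + 1) - φ i) * ((i : ℝ) + 1) = n * φ n - ∑ i ∈ range n, φ i := by
  induction n with
  | zero => simp
  | succ n ih =>
    rw [sum_range_succ, ih, sum_range_succ]
    push_cast; ring

/-- Weighted sums against weights whose partial sums are dominated by uniform ones. -/
lemma sum_mul_rpow_neg_le {α K : ℝ} (h0 : 0 < α) (h1 : α < 1) (hK : 0 ≤ K) {b : ℕ → ℝ} {n : ℕ}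
    (hb : ∀ l ≤ n, ∑ k ∈ range (l + 1), b k ≤ K * (((l : ℝ) + 1) / (n + 1))) :
    ∑ k ∈ range (n + 1), b k * ((k : ℝ) + 1) ^ (-α) ≤
      K * (1 + 1 / (1 - α)) * ((n : ℝ) + 1) ^ (-α) := by
  have hα : 0 < 1 - α := by linarith
  have hn : (0 : ℝ) < n + 1 := by positivity
  set φ : ℕ → ℝ := fun k => ((k : ℝ) + 1) ^ (-α) with hφ
  have hφ0 : ∀ k, 0 ≤ φ k := fun k => by positivity
  have hanti : ∀ i, φ (i + 1) - φ i ≤ 0 := fun i =>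
    sub_nonpos.2 (rpow_le_rpow_of_nonpos (by positivity) (by push_cast; linarith) (by linarith))
  have hparts := sum_range_by_parts φ b (n + 1)
  simp only [smul_eq_mul, add_tsub_cancel_right] at hparts
  have htail : ∑ i ∈ range n, (φ (i + 1) - φ i) * (K * (((i : ℝ) + 1) / (n + 1))) ≤
      ∑ i ∈ range n, (φ (i + 1) - φ i) * ∑ k ∈ range (i + 1), b k :=
    sum_le_sum fun i hi => mul_le_mul_of_nonpos_left (hb i (mem_range.1 hi).le) (hanti i)
  have hfac : ∑ i ∈ range n, (φ (i + 1) - φ i) * (K * (((i : ℝ) + 1) / (n + 1))) =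
      K / (n + 1) * (n * φ n - ∑ i ∈ range n, φ i) := by
    rw [← sum_sub_mul_eq, mul_sum]
    exact sum_congr rfl fun i _ => by ring
  have hhead : φ n * ∑ k ∈ range (n + 1), b k ≤ φ n * K :=
    mul_le_mul_of_nonneg_left (by simpa [div_self hn.ne'] using hb n le_rfl) (hφ0 n)
  have hsum : ∑ i ∈ range n, φ i ≤ ((n : ℝ) + 1) * (φ n / (1 - α)) := by
    refine (sum_range_rpow_neg_le h0 h1 n).trans ?_
    have : ((n : ℝ) + 1) * (φ n / (1 - α)) = ((n : ℝ) + 1) ^ (1 - α) / (1 - α) := by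
      rw [sub_eq_add_neg, rpow_add hn, rpow_one]; ring
    rw [this]
    gcongr
    linarith
  have hKn : 0 ≤ K / (n + 1) := by positivity
  calc ∑ k ∈ range (n + 1), b k * φ k = ∑ k ∈ range (n + 1), φ k * b k :=
        sum_congr rfl fun k _ => mul_comm _ _
    _ ≤ φ n * K + K / (n + 1) * ((n + 1) * (φ n / (1 - α))) := by
        have h2 := mul_le_mul_of_nonneg_left hsum hKn
        have h3 : 0 ≤ K / (n + 1) * (n * φ n) :=
          mul_nonneg hKn (mul_nonneg (Nat.cast_nonneg n) (hφ0 n))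
        rw [hparts]
        rw [hfac] at htail
        linarith
    _ = _ := by
        simp only [hφ]
        field_simp

/-- Theorem 5 (i): if `f ∈ Lip(α,p)`, `p > 1`, `0 < α < 1`, the matrix
is nonnegative, lower triangular with row sums `1`, and its rows are in `AMIMS` with a
constant independent of `n`, then `‖T_n(f) - f‖_{L^p} = O(n^{-α})`. -/
theorem trig_approx_AMIMS (p α : ℝ) (hp : 1 < p) (hα0 : 0 < α) (hα1 : α < 1)
    (f : ℝ → ℝ) (hf : LipClass α p f)
    (a : ℕ → ℕ → ℝ)
    (hpos : ∀ n k, k ≤ n → 0 ≤ a n k)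
    (hzero : ∀ n k, n < k → a n k = 0)
    (hsum : ∀ n, ∑ k ∈ Finset.range (n + 1), a n k = 1)
    (hAMIMS : ∃ K : ℝ, ∀ n l m : ℕ, l ≤ m → m ≤ n → rowMean a n l ≤ K * rowMean a n m) :
    ∃ C : ℝ, ∀ n : ℕ, 1 ≤ n →
      lpNorm p (fun x => matrixMeans a f n x - f x) ≤ C * (n : ℝ) ^ (-α) := by
  obtain ⟨A, hA, hS⟩ := exists_circNorm_partialFourierSum_sub_le hp hα0 hα1 hf
  obtain ⟨K, hK⟩ := hAMIMS
  obtain ⟨hper, hfi, -, -⟩ := hf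
  have hp0 : 0 < p := by linarith
  have hα : 0 < 1 - α := by linarith
  have hfm : AEStronglyMeasurable f periodMeasure :=
    (hper.aestronglyMeasurable (by positivity) hfi).mono_ac periodMeasure_absolutelyContinuous
  have hSm : ∀ k, AEStronglyMeasurable (fun x => partialFourierSum f k x - f x) periodMeasure := by
    intro k
    have hc : Continuous (partialFourierSum f k) := by
      rw [show partialFourierSum f k = _ from funext (partialFourierSum_eq hfi k)]
      fun_prop
    exact hc.aestronglyMeasurable.sub hfm
  have hK0 : 0 ≤ K := by
    have := hK 0 0 0 le_rfl le_rfl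
    have h0 := hsum 0
    simp only [rowMean, h0] at this
    norm_num at this
    linarith
  have hrow : ∀ n l : ℕ, l ≤ n → ∑ k ∈ range (l + 1), a n k ≤ K * (((l : ℝ) + 1) / (n + 1)) := by
    intro n l hl
    have := hK n l n hl le_rfl
    rw [rowMean, rowMean, hsum, one_div_mul_eq_div, div_le_iff₀ (by positivity)] at this
    exact this.trans (le_of_eq (by ring))
  refine ⟨A * (K * (1 + 1 / (1 - α))), fun n hn => ?_⟩
  have hn0 : (0 : ℝ) < n := by exact_mod_cast hn
  have hsub : (fun x => matrixMeans a f n x - f x) =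
      ∑ k ∈ range (n + 1), a n k • fun x => partialFourierSum f k x - f x := by
    ext x
    simp only [matrixMeans, Finset.sum_apply, Pi.smul_apply, smul_eq_mul, mul_sub]
    rw [sum_sub_distrib, ← sum_mul, hsum, one_mul]
  have hm : ∀ k ∈ range (n + 1),
      AEStronglyMeasurable (a n k • fun x => partialFourierSum f k x - f x) periodMeasure :=
    fun k _ => (hSm k).const_smul (a n k)
  have hmeas : AEStronglyMeasurable (fun x => matrixMeans a f n x - f x) periodMeasure := by
    rw [hsub]
    exact Finset.aestronglyMeasurable_sum _ hm
  have hle : circNorm p (fun x => matrixMeans a f n x - f x) ≤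
      ENNReal.ofReal (A * ∑ k ∈ range (n + 1), a n k * ((k : ℝ) + 1) ^ (-α)) := by
    rw [hsub]
    refine (eLpNorm'_sum_le hm hp.le).trans ?_
    have hnn : ∀ k ∈ range (n + 1), 0 ≤ a n k := fun k hk => hpos n k (by simp at hk; lia)
    rw [mul_sum, ENNReal.ofReal_sum_of_nonneg fun k hk =>
      mul_nonneg hA (mul_nonneg (hnn k hk) (by positivity))]
    refine sum_le_sum fun k hk => ?_
    rw [eLpNorm'_const_smul _ hp0, Real.enorm_of_nonneg (hnn k hk), mul_left_comm A,
      ENNReal.ofReal_mul (hnn k hk)]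
    gcongr
    exact hS k
  rw [lpNorm_eq_toReal_circNorm hp0 hmeas]
  refine ENNReal.toReal_le_of_le_ofReal (by positivity) (hle.trans (ENNReal.ofReal_le_ofReal ?_))
  rw [mul_assoc]
  refine mul_le_mul_of_nonneg_left ?_ hA
  refine (sum_mul_rpow_neg_le hα0 hα1 hK0 (hrow n)).trans ?_
  refine mul_le_mul_of_nonneg_left ?_ (by positivity)
  exact rpow_le_rpow_of_nonpos hn0 (by linarith) (by linarith)
end
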